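/- arXiv:1401.2874 — 10 statements merged into one kernel-verified Lean document; each statement's English description precedes it below -/
import Mathlib

section
/- Let a graphic instance of capacitated k-supplier with outliers be given in which L(u) ≤ deg_G(u) for every u ∈ ℱ, and let S ⊆ ℱ be a preskeleton. Let U = {u ∈ ℱ : d(u, S) ≥ 6}. Then S is a skeleton, or else U ≠ ∅ and, for every vertex s ∈ U maximizing L(s) among the vertices of U, the set S ∪ {s} is a preskeleton. -/
open Finset

open scoped Classical

/-- A graphic instance of capacitated `k`-supplier with outliers: a finite bipartite
graph `G` with client vertices `Cs`, facility vertices `Fs` (partitioning the vertex set),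
and edges only between the two parts. -/
def IsGraphicInstance {V : Type*} [Fintype V] (G : SimpleGraph V)
    (Cs Fs : Finset V) : Prop :=
  Disjoint Cs Fs ∧ Cs ∪ Fs = Finset.univ ∧
    ∀ u v, G.Adj u v → (u ∈ Cs ∧ v ∈ Fs) ∨ (u ∈ Fs ∧ v ∈ Cs)

/-- A distance-`τ` solution `(C, F, φ)` of a graphic instance. -/
def IsSolution {V : Type*} [Fintype V] [DecidableEq V] (G : SimpleGraph V)
    (Cs Fs : Finset V) (L : V → ℕ) (k p τ : ℕ)
    (C F : Finset V) (φ : V → V) : Prop :=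
  C ⊆ Cs ∧ F ⊆ Fs ∧ C.card = p ∧ F.card = k ∧
    (∀ v ∈ C, φ v ∈ F) ∧
    (∀ u ∈ F, (C.filter (fun v => φ v = u)).card ≤ L u) ∧
    (∀ v ∈ C, G.edist v (φ v) ≤ (τ : ℕ∞))

/-- A preskeleton: a subset of facilities satisfying the separation and injection
properties with respect to some distance-1 solution. -/
def IsPreskeleton {V : Type*} [Fintype V] [DecidableEq V] (G : SimpleGraph V)
    (Cs Fs : Finset V) (L : V → ℕ) (k p : ℕ) (S : Finset V) : Prop :=
  S ⊆ Fs ∧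
    (∀ u ∈ S, ∀ u' ∈ S, u ≠ u' → 6 ≤ G.edist u u') ∧
    ∃ C F φ, IsSolution G Cs Fs L k p 1 C F φ ∧
      ∃ f : V → V, Set.InjOn f ↑S ∧ ∀ u ∈ S, f u ∈ F ∧ G.edist u (f u) ≤ 2

/-- A skeleton: a preskeleton whose witnessing distance-1 solution moreover satisfies the
covering property. -/
def IsSkeleton {V : Type*} [Fintype V] [DecidableEq V] (G : SimpleGraph V)
    (Cs Fs : Finset V) (L : V → ℕ) (k p : ℕ) (S : Finset V) : Prop :=
  S ⊆ Fs ∧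
    (∀ u ∈ S, ∀ u' ∈ S, u ≠ u' → 6 ≤ G.edist u u') ∧
    ∃ C F φ, IsSolution G Cs Fs L k p 1 C F φ ∧
      (∀ u ∈ F, ∃ s ∈ S, G.edist u s ≤ 4) ∧
      ∃ f : V → V, Set.InjOn f ↑S ∧ ∀ u ∈ S, f u ∈ F ∧ G.edist u (f u) ≤ 2

/-- In a graphic instance, a walk has even length iff its ends lie on the same side. -/
lemma IsGraphicInstance.even_length_iff {V : Type*} [Fintype V] {G : SimpleGraph V}
    {Cs Fs : Finset V} (hinst : IsGraphicInstance G Cs Fs) {u v : V} (w : G.Walk u v) :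
    Even w.length ↔ (u ∈ Fs ↔ v ∈ Fs) := by
  induction w with
  | nil => simp
  | @cons a b c h w ih =>
    rw [SimpleGraph.Walk.length_cons, Nat.even_add_one, ih]
    have hdisj : ∀ x, x ∈ Cs → x ∉ Fs := fun x hx => Finset.disjoint_left.mp hinst.1 hx
    rcases hinst.2.2 a b h with ⟨ha, hb⟩ | ⟨ha, hb⟩
    · have := hdisj a ha
      tauto
    · have := hdisj b hb
      tauto

/-- Facilities of a graphic instance at distance more than 4 are at distance at least 6. -/
lemma IsGraphicInstance.six_le_edist {V : Type*} [Fintype V] {G : SimpleGraph V}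
    {Cs Fs : Finset V} (hinst : IsGraphicInstance G Cs Fs) {u v : V} (hu : u ∈ Fs)
    (hv : v ∈ Fs) (h : 4 < G.edist u v) : 6 ≤ G.edist u v := by
  by_cases htop : G.edist u v = ⊤
  · simp [htop]
  · obtain ⟨w, hw⟩ := SimpleGraph.exists_walk_of_edist_ne_top htop
    have heven := (hinst.even_length_iff w).2 (by simp [hu, hv])
    rw [← hw] at h ⊢
    have h4 : 4 < w.length := by exact_mod_cast h
    have h6 : 6 ≤ w.length := by
      obtain ⟨m, hm⟩ := heven
      omega
    exact_mod_cast h6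

/-- A solution can swap an open facility `u₀` for a facility `s` of at least the same capacity
that has no open facility within distance 2. -/
lemma IsSolution.exists_swap {V : Type*} [Fintype V] [DecidableEq V] {G : SimpleGraph V}
    [DecidableRel G.Adj] {Cs Fs : Finset V} {L : V → ℕ} {k p : ℕ}
    (hinst : IsGraphicInstance G Cs Fs) {C F : Finset V} {φ : V → V}
    (hsol : IsSolution G Cs Fs L k p 1 C F φ) {u₀ s : V} (hu₀ : u₀ ∈ F) (hs : s ∈ Fs)
    (hL : L u₀ ≤ L s) (hdeg : L s ≤ G.degree s) (hfar : ∀ u ∈ F, ¬ G.edist s u ≤ 2) :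
    ∃ C' φ', IsSolution G Cs Fs L k p 1 C' (insert s (F.erase u₀)) φ' := by
  obtain ⟨hC, hF, hCp, hFk, hφ, hcap, hdist⟩ := hsol
  have hsF : s ∉ F := fun h => hfar s h (by simp)
  have hNC : ∀ v, G.Adj s v → v ∉ C := by
    intro v hv hvC
    refine hfar (φ v) (hφ v hvC) ?_
    calc G.edist s (φ v) ≤ G.edist s v + G.edist v (φ v) := SimpleGraph.edist_triangle
      _ ≤ 1 + 1 := add_le_add (SimpleGraph.edist_eq_one_iff_adj.2 hv).le
          (by simpa using hdist v hvC)
      _ = 2 := by norm_num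
  set A := C.filter (fun v => φ v = u₀) with hA
  have hAs : A.card ≤ L s := (hcap u₀ hu₀).trans hL
  obtain ⟨B, hBN, hBA⟩ := Finset.exists_subset_card_eq
    (s := G.neighborFinset s) (n := A.card) (hAs.trans hdeg)
  have hBadj : ∀ v ∈ B, G.Adj s v := fun v hv => by simpa using hBN hv
  have hBC : ∀ v ∈ B, v ∉ C := fun v hv => hNC v (hBadj v hv)
  refine ⟨(C \ A) ∪ B, fun v => if v ∈ B then s else φ v, ?_, ?_, ?_, ?_, ?_, ?_, ?_⟩
  · intro v hv
    rcases Finset.mem_union.1 hv with h | h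
    · exact hC (Finset.mem_sdiff.1 h).1
    · rcases hinst.2.2 s v (hBadj v h) with h' | h'
      · exact absurd hs (Finset.disjoint_left.1 hinst.1 h'.1)
      · exact h'.2
  · intro v hv
    rcases Finset.mem_insert.1 hv with rfl | h
    · exact hs
    · exact hF (Finset.mem_of_mem_erase h)
  · rw [Finset.card_union_of_disjoint, Finset.card_sdiff_of_subset (Finset.filter_subset _ _),
      hBA, Nat.sub_add_cancel (Finset.card_le_card (Finset.filter_subset _ _)), hCp]
    exact Finset.disjoint_left.2 fun v hv hB => hBC v hB (Finset.mem_sdiff.1 hv).1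
  · rw [Finset.card_insert_of_notMem fun h => hsF (Finset.mem_of_mem_erase h),
      Finset.card_erase_add_one hu₀, hFk]
  · intro v hv
    by_cases hB : v ∈ B
    · simp [hB]
    · have hv' : v ∈ C ∧ φ v ≠ u₀ := by
        have : v ∈ C \ A := (Finset.mem_union.1 hv).resolve_right hB
        simp only [hA, Finset.mem_sdiff, Finset.mem_filter, not_and] at this
        exact ⟨this.1, this.2 this.1⟩
      simp [hB, hv'.2, hφ v hv'.1]
  · intro u hu
    rcases Finset.mem_insert.1 hu with rfl | h
    · refine (Finset.card_le_card ?_).trans (hBA.trans_le hAs)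
      intro v hv
      obtain ⟨hv, hvu⟩ := Finset.mem_filter.1 hv
      by_contra hB
      have hvC : v ∈ C := (Finset.mem_sdiff.1 ((Finset.mem_union.1 hv).resolve_right hB)).1
      simp only [if_neg hB] at hvu
      exact hsF (hvu ▸ hφ v hvC)
    · have huF := Finset.mem_of_mem_erase h
      refine (Finset.card_le_card ?_).trans (hcap u huF)
      intro v hv
      obtain ⟨hv, hvu⟩ := Finset.mem_filter.1 hv
      by_cases hB : v ∈ B
      · simp only [if_pos hB] at hvu
        exact absurd (hvu ▸ huF) hsF
      · simp only [if_neg hB] at hvu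
        exact Finset.mem_filter.2
          ⟨(Finset.mem_sdiff.1 ((Finset.mem_union.1 hv).resolve_right hB)).1, hvu⟩
  · intro v hv
    by_cases hB : v ∈ B
    · simpa [hB] using (SimpleGraph.edist_eq_one_iff_adj.2 (hBadj v hB).symm).le
    · simpa [hB] using
        hdist v (Finset.mem_sdiff.1 ((Finset.mem_union.1 hv).resolve_right hB)).1

/-- If `L(u) ≤ deg(u)` for all facilities and `S` is a preskeleton, then
either `S` is a skeleton, or the set `U` of facilities at distance at least 6 from `S` is
nonempty and adding any highest-capacity vertex of `U` to `S` yields a preskeleton. -/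
theorem preskeleton_extension {V : Type*} [Fintype V] [DecidableEq V]
    (G : SimpleGraph V) [DecidableRel G.Adj] (Cs Fs : Finset V) (L : V → ℕ) (k p : ℕ)
    (hinst : IsGraphicInstance G Cs Fs)
    (hdeg : ∀ u ∈ Fs, L u ≤ G.degree u)
    (S : Finset V) (hS : IsPreskeleton G Cs Fs L k p S)
    (U : Finset V) (hU : U = Fs.filter (fun u => ∀ s ∈ S, 6 ≤ G.edist u s)) :
    IsSkeleton G Cs Fs L k p S ∨
      (U.Nonempty ∧ ∀ s ∈ U, (∀ u ∈ U, L u ≤ L s) →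
        IsPreskeleton G Cs Fs L k p (insert s S)) := by
  obtain ⟨hSF, hsep, C, F, φ, hsol, f, hinj, hf⟩ := hS
  by_cases hcov : ∀ u ∈ F, ∃ s ∈ S, G.edist u s ≤ 4
  · exact Or.inl ⟨hSF, hsep, C, F, φ, hsol, hcov, f, hinj, hf⟩
  right
  push Not at hcov
  obtain ⟨u₀, hu₀, hu₀S⟩ := hcov
  have hu₀Fs : u₀ ∈ Fs := hsol.2.1 hu₀
  have hu₀far : ∀ s ∈ S, 6 ≤ G.edist u₀ s := fun s hs =>
    hinst.six_le_edist hu₀Fs (hSF hs) (hu₀S s hs)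
  have hu₀U : u₀ ∈ U := by simpa [hU] using ⟨hu₀Fs, hu₀far⟩
  refine ⟨⟨u₀, hu₀U⟩, fun s hsU hmax => ?_⟩
  obtain ⟨hsFs, hsfar⟩ : s ∈ Fs ∧ ∀ t ∈ S, 6 ≤ G.edist s t := by simpa [hU] using hsU
  have hfar4 : ∀ x, (∀ t ∈ S, 6 ≤ G.edist x t) → ∀ t ∈ S, ¬ G.edist x (f t) ≤ 2 := by
    intro x hx t ht hle
    have h4 : G.edist x t ≤ 2 + 2 := SimpleGraph.edist_triangle.trans
      (add_le_add hle (SimpleGraph.edist_comm.trans_le (hf t ht).2))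
    exact absurd ((hx t ht).trans h4) (by decide)
  have hsS : s ∉ S := fun h => absurd (hsfar s h) (by simp)
  have hsub : insert s S ⊆ Fs := Finset.insert_subset hsFs hSF
  have hsep' : ∀ u ∈ insert s S, ∀ u' ∈ insert s S, u ≠ u' → 6 ≤ G.edist u u' := by
    intro u hu u' hu' hne
    rcases Finset.mem_insert.1 hu with rfl | huS <;>
      rcases Finset.mem_insert.1 hu' with rfl | huS'
    · exact absurd rfl hne
    · exact hsfar u' huS'
    · exact (hsfar u huS).trans_eq SimpleGraph.edist_comm
    · exact hsep u huS u' huS' hne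
  have hext : ∀ (x : V) (F' : Finset V), x ∈ F' → G.edist s x ≤ 2 → (∀ t ∈ S, f t ∈ F') →
      ∃ g : V → V, Set.InjOn g ↑(insert s S) ∧
        ∀ u ∈ insert s S, g u ∈ F' ∧ G.edist u (g u) ≤ 2 := by
    intro x F' hxF hx hfF
    have hg : ∀ t ∈ S, Function.update f s x t = f t := fun t ht =>
      Function.update_of_ne (ne_of_mem_of_not_mem ht hsS) _ _
    refine ⟨Function.update f s x, ?_, ?_⟩
    · rw [Finset.coe_insert, Set.injOn_insert (by simpa using hsS)]
      refine ⟨hinj.congr fun t ht => (hg t ht).symm, ?_⟩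
      rintro ⟨t, ht, hte⟩
      rw [hg t ht, Function.update_self] at hte
      exact hfar4 s hsfar t ht (hte ▸ hx)
    · intro u hu
      rcases Finset.mem_insert.1 hu with rfl | hu
      · simpa using ⟨hxF, hx⟩
      · rw [hg u hu]
        exact ⟨hfF u hu, (hf u hu).2⟩
  by_cases hnear : ∃ x ∈ F, G.edist s x ≤ 2
  · obtain ⟨x, hxF, hx⟩ := hnear
    exact ⟨hsub, hsep', C, F, φ, hsol, hext x F hxF hx fun t ht => (hf t ht).1⟩
  · obtain ⟨C', φ', hsol'⟩ := hsol.exists_swap hinst hu₀ hsFs (hmax u₀ hu₀U) (hdeg s hsFs)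
      fun u hu hle => hnear ⟨u, hu, hle⟩
    refine ⟨hsub, hsep', C', _, φ', hsol', hext s _ (Finset.mem_insert_self _ _) (by simp) ?_⟩
    refine fun t ht => Finset.mem_insert_of_mem (Finset.mem_erase.2 ⟨fun h => ?_, (hf t ht).1⟩)
    exact hfar4 u₀ hu₀far t ht (by simp [h])
end

section
/- If S ⊆ ℱ is a skeleton of a graphic instance of capacitated k-supplier with outliers, then LP_{k,p}(G, L, S) has a feasible solution. -/
open Finset

open scoped Classical

/-- The constraints of the linear program `LP_{k,p}(G, L, S)` for an explicit pair `(x, y)`. -/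
def LPSat {V : Type*} [Fintype V] (G : SimpleGraph V) (Cs Fs : Finset V)
    (L : V → ℕ) (k p : ℕ) (S : Finset V) (x : V → V → ℝ) (y : V → ℝ) : Prop :=
  (∀ u, 0 ≤ y u ∧ y u ≤ 1) ∧
    (∀ u v, 0 ≤ x u v ∧ x u v ≤ 1) ∧
    (∑ u ∈ Fs, y u = k) ∧
    (∑ u ∈ Fs, ∑ v ∈ Cs, x u v = p) ∧
    (∀ u ∈ Fs, ∀ v ∈ Cs, x u v ≤ y u) ∧
    (∀ u ∈ Fs, ∑ v ∈ Cs, x u v ≤ (L u : ℝ) * y u) ∧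
    (∀ v ∈ Cs, ∑ u ∈ Fs, x u v ≤ 1) ∧
    (∀ s ∈ S, 1 ≤ ∑ u ∈ Fs.filter (fun u => G.edist u s ≤ 2), y u) ∧
    (∀ u ∈ Fs, ∀ v ∈ Cs, ¬ G.Adj v u → x u v = 0)

/-- Feasibility of the linear program `LP_{k,p}(G, L, S)`. -/
def LPFeasible {V : Type*} [Fintype V] (G : SimpleGraph V) (Cs Fs : Finset V)
    (L : V → ℕ) (k p : ℕ) (S : Finset V) : Prop :=
  ∃ x y, LPSat G Cs Fs L k p S x y

/-- If `S` is a skeleton of a graphic instance, then `LP_{k,p}(G, L, S)`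
has a feasible solution. -/
theorem skeleton_lp_feasible {V : Type*} [Fintype V] [DecidableEq V]
    (G : SimpleGraph V) (Cs Fs : Finset V) (L : V → ℕ) (k p : ℕ)
    (hinst : IsGraphicInstance G Cs Fs)
    (S : Finset V) (hS : IsSkeleton G Cs Fs L k p S) :
    LPFeasible G Cs Fs L k p S := by
  obtain ⟨hdisj, -, -⟩ := hinst
  obtain ⟨-, -, C, F, φ, ⟨hC, hF, hCp, hFk, hφF, hcap, hdist⟩, -, f, -, hf⟩ := hS
  have hadj : ∀ v ∈ C, G.Adj v (φ v) := by
    intro v hv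
    have hne : v ≠ φ v := Finset.disjoint_iff_ne.1 hdisj v (hC hv) _ (hF (hφF v hv))
    have h1 : G.edist v (φ v) = 1 :=
      le_antisymm (by simpa using hdist v hv)
        (Order.one_le_iff_pos.2 (SimpleGraph.edist_pos_of_ne hne))
    exact SimpleGraph.edist_eq_one_iff_adj.1 h1
  have hrow : ∀ u, ∑ v ∈ Cs, (if v ∈ C ∧ φ v = u then (1 : ℝ) else 0) =
      (C.filter (fun v => φ v = u)).card := by
    intro u
    rw [Finset.sum_boole]
    congr 2
    ext v
    simp only [Finset.mem_filter]
    exact ⟨fun h => h.2, fun h => ⟨hC h.1, h⟩⟩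
  have hcol : ∀ v, ∑ u ∈ Fs, (if v ∈ C ∧ φ v = u then (1 : ℝ) else 0) =
      if v ∈ C then 1 else 0 := by
    intro v
    by_cases hv : v ∈ C
    · simp [hv, hF (hφF v hv)]
    · simp [hv]
  refine ⟨fun u v => if v ∈ C ∧ φ v = u then 1 else 0, fun u => if u ∈ F then 1 else 0,
    ?_, ?_, ?_, ?_, ?_, ?_, ?_, ?_, ?_⟩
  · intro u
    dsimp only
    split_ifs <;> norm_num
  · intro u v
    dsimp only
    split_ifs <;> norm_num
  · rw [Finset.sum_boole, Finset.filter_mem_eq_inter, Finset.inter_eq_right.2 hF, hFk]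
  · rw [Finset.sum_comm, Finset.sum_congr rfl fun v _ => hcol v, Finset.sum_boole,
      Finset.filter_mem_eq_inter, Finset.inter_eq_right.2 hC, hCp]
  · intro u _ v _
    dsimp only
    split_ifs with h h'
    · exact le_rfl
    · exact absurd (h.2 ▸ hφF v h.1) h'
    · exact zero_le_one
    · exact le_rfl
  · intro u _
    rw [hrow u]
    by_cases hu : u ∈ F
    · simpa [hu] using hcap u hu
    · have hempty : C.filter (fun v => φ v = u) = ∅ :=
        Finset.filter_eq_empty_iff.2 fun v hv h => hu (h ▸ hφF v hv)
      simp [hu, hempty]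
  · intro v _
    rw [hcol v]
    split_ifs <;> norm_num
  · intro s hs
    obtain ⟨hfs, hds⟩ := hf s hs
    have hmem : f s ∈ Fs.filter (fun u => G.edist u s ≤ 2) :=
      Finset.mem_filter.2 ⟨hF hfs, SimpleGraph.edist_comm (G := G) ▸ hds⟩
    refine le_trans ?_ (Finset.single_le_sum (fun u _ => ?_) hmem)
    · simp [hfs]
    · split_ifs <;> norm_num
  · intro u _ v _ hnadj
    exact if_neg fun h : v ∈ C ∧ φ v = u => hnadj (h.2 ▸ hadj v h.1)
end

section
/- Let S ⊆ ℱ in a graphic instance of capacitated k-supplier with outliers, let G₁, …, G_ℓ be the connected components of the subgraph of G induced on the vertices v with d(v, S) ≤ 5, let 𝒞_i and ℱ_i denote the client and facility vertices of G_i, and let S_i = S ∩ ℱ_i. If S is a skeleton, then there exist nonnegative integers k₁, …, k_ℓ and p₁, …, p_ℓ with Σ_{i=1}^ℓ k_i = k and Σ_{i=1}^ℓ p_i = p such that for every i the linear program LP_{k_i,p_i}(G_i, L restricted to ℱ_i, S_i) has a feasible solution. -/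
open Finset

open scoped Classical

/-- If the ball of radius `n` around `a` lies in `N`, then any vertex within distance `n` of `a`
is within distance `n` of `a` in the subgraph induced on `N`. -/
theorem edist_induce_le {V : Type*} (G : SimpleGraph V) (N : Set V) (n : ℕ) (a b : N)
    (hN : ∀ w, G.edist w a ≤ n → w ∈ N) (hab : G.edist (a : V) b ≤ n) :
    (G.induce N).edist a b ≤ n := by
  obtain ⟨p, hp⟩ := SimpleGraph.exists_walk_of_edist_ne_top
    (ne_top_of_le_ne_top (ENat.natCast_ne_top n) hab)
  have hsupp : ∀ w ∈ p.support, w ∈ N := by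
    intro w hw
    apply hN
    rw [SimpleGraph.edist_comm]
    refine (SimpleGraph.edist_le (p.takeUntil w hw)).trans ?_
    rw [← hp] at hab
    exact le_trans (by exact_mod_cast p.length_takeUntil_le_length hw) hab
  have h := SimpleGraph.edist_le (p.induce N hsupp)
  have hlen : (p.induce N hsupp).length = p.length := by
    conv_rhs => rw [← p.map_induce hsupp]
    exact (SimpleGraph.Walk.length_map _ _).symm
  rw [hlen, hp] at h
  exact h.trans hab

/-- The elements of `A` lying in `N` can be counted class by class for any map out of `N`. -/
theorem sum_card_filter_subtype {V ι : Type*} [Fintype ι] (N A : Finset V) (hA : A ⊆ N)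
    (g : ↥(↑N : Set V) → ι) :
    ∑ c, #{v : ↥(↑N : Set V) | (v : V) ∈ A ∧ g v = c} = #A := by
  have h := Finset.card_eq_sum_card_fiberwise (f := g) (s := {v : ↥(↑N : Set V) | (v : V) ∈ A})
    (t := univ) (fun _ _ => Finset.mem_coe.2 (mem_univ _))
  simp only [Finset.filter_filter] at h
  rw [← h]
  refine Finset.card_bij (fun v _ => (v : V)) ?_ ?_ ?_
  · simp
  · intro a _ b _ hab
    exact Subtype.ext hab
  · intro b hb
    exact ⟨⟨b, hA hb⟩, by simpa using hb, rfl⟩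

/-- If `S` is a skeleton, then `k` and `p` can be split among the connected
components of the subgraph of `G` induced on the vertices at distance at most 5 from `S`
so that each component's linear program (with clients, facilities, capacities and `S`
restricted to the component) is feasible. -/
theorem skeleton_decomposition {V : Type*} [Fintype V] [DecidableEq V]
    (G : SimpleGraph V) (Cs Fs : Finset V) (L : V → ℕ) (k p : ℕ)
    (hinst : IsGraphicInstance G Cs Fs)
    (S : Finset V) (hS : IsSkeleton G Cs Fs L k p S)
    (Near : Finset V) (hNear : Near = Finset.univ.filter (fun v => ∃ s ∈ S, G.edist v s ≤ 5))
    (G5 : SimpleGraph ↥(↑Near : Set V)) (hG5 : G5 = G.induce (↑Near : Set V)) :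
    ∃ κ π : G5.ConnectedComponent → ℕ,
      (∑ c : G5.ConnectedComponent, κ c = k) ∧
      (∑ c : G5.ConnectedComponent, π c = p) ∧
      ∀ c : G5.ConnectedComponent,
        LPFeasible G5
          (Finset.univ.filter (fun v => (v : V) ∈ Cs ∧ G5.connectedComponentMk v = c))
          (Finset.univ.filter (fun v => (v : V) ∈ Fs ∧ G5.connectedComponentMk v = c))
          (fun v => L (v : V)) (κ c) (π c)
          (Finset.univ.filter (fun v => (v : V) ∈ S ∧ G5.connectedComponentMk v = c)) := by
  obtain ⟨hdisj, -, -⟩ := hinst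
  obtain ⟨-, -, C, F, φ, ⟨hCC, hFF, hCp, hFk, hφF, hcap, hdist⟩, hcov, f, -, hf⟩ := hS
  have hmem : ∀ v, v ∈ Near ↔ ∃ s ∈ S, G.edist v s ≤ 5 := by simp [hNear]
  clear hNear
  have hadj : ∀ v ∈ C, G.Adj v (φ v) := by
    intro v hv
    have hne : v ≠ φ v := fun h =>
      Finset.disjoint_left.1 hdisj (hCC hv) (h ▸ hFF (hφF v hv))
    rw [← SimpleGraph.edist_eq_one_iff_adj]
    exact le_antisymm (by simpa using hdist v hv)
      (Order.one_le_iff_pos.2 (SimpleGraph.edist_pos_of_ne hne))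
  have hFN : F ⊆ Near := by
    intro u hu
    obtain ⟨s, hs, h⟩ := hcov u hu
    exact (hmem u).2 ⟨s, hs, h.trans (by norm_num)⟩
  have hCN : C ⊆ Near := by
    intro v hv
    obtain ⟨s, hs, h⟩ := hcov _ (hφF v hv)
    refine (hmem v).2 ⟨s, hs, (SimpleGraph.edist_triangle (v := φ v)).trans ?_⟩
    rw [SimpleGraph.edist_eq_one_iff_adj.2 (hadj v hv)]
    exact (add_le_add_right h 1).trans (by norm_num)
  have hball : ∀ s ∈ S, ∀ w, G.edist w s ≤ (2 : ℕ) → w ∈ (↑Near : Set V) := by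
    intro s hs w hw
    exact (hmem w).2 ⟨s, hs, hw.trans (by norm_num)⟩
  have hadj₅ : ∀ a b : ↥(↑Near : Set V), G.Adj a b → G5.Adj a b := fun a b hab => hG5 ▸ hab
  have hdist₅ : ∀ s ∈ S, ∀ a b : ↥(↑Near : Set V), (a : V) = s → G.edist (a : V) b ≤ (2 : ℕ) →
      G5.edist a b ≤ (2 : ℕ) := by
    rintro s hs a b rfl hab
    rw [hG5]
    exact edist_induce_le G _ 2 a b (hball _ hs) hab
  clear hG5
  refine ⟨fun c => #{v : ↥(↑Near : Set V) | (v : V) ∈ F ∧ G5.connectedComponentMk v = c},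
    fun c => #{v : ↥(↑Near : Set V) | (v : V) ∈ C ∧ G5.connectedComponentMk v = c},
    ?_, ?_, fun c => ?_⟩
  · rw [← hFk, ← sum_card_filter_subtype Near F hFN G5.connectedComponentMk]
    congr!
  · rw [← hCp, ← sum_card_filter_subtype Near C hCN G5.connectedComponentMk]
    congr!
  refine ⟨fun u v => if (v : V) ∈ C ∧ φ v = u then 1 else 0,
    fun u => if (u : V) ∈ F then 1 else 0, ?_, ?_, ?_, ?_, ?_, ?_, ?_, ?_, ?_⟩
  · intro u
    dsimp only
    split_ifs <;> norm_num
  · intro u v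
    dsimp only
    split_ifs <;> norm_num
  · rw [Finset.sum_boole, Finset.filter_filter]
    congr 2
    ext u
    simp only [Finset.mem_filter, Finset.mem_univ, true_and]
    exact ⟨fun h => ⟨h.2, h.1.2⟩, fun h => ⟨⟨hFF h.1, h.2⟩, h.1⟩⟩
  · rw [Finset.sum_comm]
    trans ∑ v ∈ univ.filter (fun v : ↥(↑Near : Set V) =>
      (v : V) ∈ Cs ∧ G5.connectedComponentMk v = c), if (v : V) ∈ C then (1 : ℝ) else 0
    · refine Finset.sum_congr rfl fun v hv => ?_
      by_cases hvC : (v : V) ∈ C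
      · have hφv := hφF _ hvC
        have hvu : G5.Adj v ⟨φ v, hFN hφv⟩ := hadj₅ _ _ (hadj _ hvC)
        rw [Finset.sum_eq_single ⟨φ v, hFN hφv⟩]
        · simp [hvC]
        · intro u _ hu
          exact if_neg fun h => hu (Subtype.ext h.2.symm)
        · intro h
          refine absurd ?_ h
          simp only [Finset.mem_filter, Finset.mem_univ, true_and] at hv ⊢
          exact ⟨hFF hφv, hv.2 ▸ SimpleGraph.ConnectedComponent.sound hvu.symm.reachable⟩
      · simp [hvC]
    · rw [Finset.sum_boole, Finset.filter_filter]
      congr 2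
      ext u
      simp only [Finset.mem_filter, Finset.mem_univ, true_and]
      exact ⟨fun h => ⟨h.2, h.1.2⟩, fun h => ⟨⟨hCC h.1, h.2⟩, h.1⟩⟩
  · intro u _ v _
    dsimp only
    by_cases h : (v : V) ∈ C ∧ φ v = u
    · rw [if_pos h, if_pos (h.2 ▸ hφF _ h.1)]
    · rw [if_neg h]
      split_ifs <;> norm_num
  · intro u _
    dsimp only
    by_cases huF : (u : V) ∈ F
    · rw [if_pos huF, mul_one, Finset.sum_boole]
      refine Nat.cast_le.2 (le_trans ?_ (hcap u huF))
      refine Finset.card_le_card_of_injOn Subtype.val ?_ Subtype.val_injective.injOn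
      intro v hv
      simp only [Finset.coe_filter, Finset.mem_filter, Set.mem_ofPred_eq] at hv ⊢
      exact hv.2
    · rw [if_neg huF, mul_zero]
      refine (Finset.sum_eq_zero fun v _ => if_neg fun h => huF ?_).le
      exact h.2 ▸ hφF _ h.1
  · intro v _
    rw [Finset.sum_boole]
    refine Nat.cast_le_one.2 (Finset.card_le_one.2 fun a ha b hb => Subtype.ext ?_)
    simp only [Finset.mem_filter] at ha hb
    exact ha.2.2.symm.trans hb.2.2
  · intro s hs
    simp only [Finset.mem_filter, Finset.mem_univ, true_and] at hs
    obtain ⟨hfF, hfd⟩ := hf s hs.1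
    have hd : G5.edist s ⟨f s, hFN hfF⟩ ≤ (2 : ℕ) :=
      hdist₅ s hs.1 _ _ rfl hfd
    have hreach : G5.Reachable s ⟨f s, hFN hfF⟩ :=
      SimpleGraph.reachable_of_edist_ne_top (ne_top_of_le_ne_top (ENat.natCast_ne_top 2) hd)
    refine le_trans (le_of_eq ?_) (Finset.single_le_sum (a := ⟨f s, hFN hfF⟩) ?_ ?_)
    · simp [hfF]
    · intro u _
      split_ifs <;> norm_num
    · simp only [Finset.mem_filter, Finset.mem_univ, true_and]
      refine ⟨⟨hFF hfF, ?_⟩, ?_⟩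
      · exact (SimpleGraph.ConnectedComponent.sound hreach.symm).trans hs.2
      · rw [SimpleGraph.edist_comm]
        exact hd
  · intro u _ v _ huv
    refine if_neg fun h => huv ?_
    exact hadj₅ _ _ (h.2 ▸ hadj _ h.1)
end

section
/- Let (G, L, k, p) be a graphic instance of capacitated k-supplier with outliers and let S ⊆ ℱ. Suppose that (i) G is connected, (ii) d(u,u') ≥ 6 for all distinct u, u' ∈ S, (iii) every vertex of G is at distance at most 5 from S, and (iv) LP_{k,p}(G, L, S) has a feasible solution. Then the instance admits a distance-25 solution. -/
open Finset

open scoped Classical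

/-- In the rooted forest given by `par` (with fixed points as roots), the vertices `a` and `b`
are at tree distance at most two. -/
def Near {V : Type*} (par : V → V) (a b : V) : Prop :=
  par a = par b ∨ par a = b ∨ par b = a ∨ par (par a) = b ∨ par (par b) = a

/-- Opening the facilities in `F` gives every set `U ⊆ N` at least as much capacity among the
vertices near `U` as the fractional opening `y` provides on `U` itself. -/
def Covers {V : Type*} (par : V → V) (N : Finset V) (L y : V → ℝ) (F : Finset V) : Prop :=
  ∀ U ⊆ N, ∑ u ∈ U, L u * y u ≤ ∑ b ∈ F with ∃ a ∈ U, Near par a b, L b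

theorem sum_le_pair_add_sum_sdiff {V : Type*} (U : Finset V) (g : V → ℝ) {u v : V}
    (huv : u ≠ v) (hu : 0 ≤ g u) (hv : 0 ≤ g v) :
    ∑ a ∈ U, g a ≤ g u + g v + ∑ a ∈ U \ {u, v}, g a := by
  have hpair : ∑ a ∈ ({u, v} : Finset V), g a = g u + g v := Finset.sum_pair huv
  rw [← Finset.sum_inter_add_sum_sdiff U ({u, v} : Finset V) g, ← hpair]
  refine add_le_add (Finset.sum_le_sum_of_subset_of_nonneg ?_ ?_) le_rfl
  · exact Finset.inter_subset_right
  · intro i hi _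
    rcases Finset.mem_insert.1 hi with rfl | hi
    · exact hu
    · rwa [Finset.mem_singleton.1 hi]

theorem covers_of_merge {V : Type*} {par : V → V} {N F : Finset V} {L y : V → ℝ} {u v : V}
    (hL : ∀ a, 0 ≤ L a) (hu : u ∈ N) (huv : u ≠ v)
    (hyu : 0 ≤ y u) (hyv : 0 ≤ y v) (hle : L v ≤ L u) (hF : F ⊆ N)
    (htwin : ∀ b ∈ N, Near par u b → Near par v b)
    (h : Covers par (N.erase v) L (Function.update y u (y u + y v)) F) :
    Covers par N L y F := by
  intro U hU
  by_cases hmem : u ∈ U ∨ v ∈ U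
  · have hW : ∀ a ∈ U \ {u, v}, a ≠ u ∧ a ≠ v ∧ a ∈ U := by
      intro a ha
      simp only [Finset.mem_sdiff, Finset.mem_insert, Finset.mem_singleton, not_or] at ha
      tauto
    have hsum := h (insert u (U \ {u, v})) (by
      intro a ha
      rcases Finset.mem_insert.1 ha with rfl | ha
      · exact Finset.mem_erase.2 ⟨huv, hu⟩
      · exact Finset.mem_erase.2 ⟨(hW a ha).2.1, hU (hW a ha).2.2⟩)
    rw [Finset.sum_insert (by simp)] at hsum
    have hcongr : ∑ a ∈ U \ {u, v}, L a * Function.update y u (y u + y v) a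
        = ∑ a ∈ U \ {u, v}, L a * y a :=
      Finset.sum_congr rfl fun a ha => by rw [Function.update_of_ne (hW a ha).1]
    rw [hcongr, Function.update_self] at hsum
    have hpair := sum_le_pair_add_sum_sdiff U (fun a => L a * y a) huv
      (mul_nonneg (hL u) hyu) (mul_nonneg (hL v) hyv)
    have hmul := mul_le_mul_of_nonneg_right hle hyv
    have hmono : ∑ b ∈ F with ∃ a ∈ insert u (U \ {u, v}), Near par a b, L b
        ≤ ∑ b ∈ F with ∃ a ∈ U, Near par a b, L b := by
      refine Finset.sum_le_sum_of_subset_of_nonneg ?_ fun i _ _ => hL i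
      intro b hb
      obtain ⟨hbF, a, ha, hab⟩ := Finset.mem_filter.1 hb
      refine Finset.mem_filter.2 ⟨hbF, ?_⟩
      rcases Finset.mem_insert.1 ha with rfl | ha
      · rcases hmem with hm | hm
        · exact ⟨a, hm, hab⟩
        · exact ⟨v, hm, htwin b (hF hbF) hab⟩
      · exact ⟨a, (hW a ha).2.2, hab⟩
    linarith
  · push Not at hmem
    refine le_trans (le_of_eq ?_) (h U fun a ha => Finset.mem_erase.2
      ⟨fun h => hmem.2 (h ▸ ha), hU ha⟩)
    exact Finset.sum_congr rfl fun a ha => by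
      rw [Function.update_of_ne (ne_of_mem_of_not_mem ha hmem.1)]

theorem covers_insert_of_open {V : Type*} {par : V → V} {N F : Finset V} {L y : V → ℝ} {u v : V}
    (hL : ∀ a, 0 ≤ L a) (hv : v ∈ N) (huv : u ≠ v)
    (hyu : 0 ≤ y u) (hyu' : y u ≤ 1) (hyv : 0 ≤ y v) (hle : L v ≤ L u)
    (hF : F ⊆ N.erase u) (hpar : par u = par v)
    (htwin : ∀ b ∈ N, Near par v b → Near par u b)
    (h : Covers par (N.erase u) L (Function.update y v (y u + y v - 1)) F) :
    Covers par N L y (insert u F) := by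
  intro U hU
  by_cases hmem : u ∈ U ∨ v ∈ U
  · have hW : ∀ a ∈ U \ {u, v}, a ≠ u ∧ a ≠ v ∧ a ∈ U := by
      intro a ha
      simp only [Finset.mem_sdiff, Finset.mem_insert, Finset.mem_singleton, not_or] at ha
      tauto
    have hsum := h (insert v (U \ {u, v})) (by
      intro a ha
      rcases Finset.mem_insert.1 ha with rfl | ha
      · exact Finset.mem_erase.2 ⟨huv.symm, hv⟩
      · exact Finset.mem_erase.2 ⟨(hW a ha).1, hU (hW a ha).2.2⟩)
    rw [Finset.sum_insert (by simp)] at hsum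
    have hcongr : ∑ a ∈ U \ {u, v}, L a * Function.update y v (y u + y v - 1) a
        = ∑ a ∈ U \ {u, v}, L a * y a :=
      Finset.sum_congr rfl fun a ha => by rw [Function.update_of_ne (hW a ha).2.1]
    rw [hcongr, Function.update_self] at hsum
    have hpair := sum_le_pair_add_sum_sdiff U (fun a => L a * y a) huv
      (mul_nonneg (hL u) hyu) (mul_nonneg (hL v) hyv)
    have hmul := mul_le_mul_of_nonneg_right hle (sub_nonneg.2 hyu')
    have hmono : L u + ∑ b ∈ F with ∃ a ∈ insert v (U \ {u, v}), Near par a b, L b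
        ≤ ∑ b ∈ insert u F with ∃ a ∈ U, Near par a b, L b := by
      rw [← Finset.sum_insert (a := u)
        (fun hm => Finset.notMem_erase u N (hF (Finset.mem_filter.1 hm).1))]
      refine Finset.sum_le_sum_of_subset_of_nonneg ?_ fun i _ _ => hL i
      intro b hb
      rcases Finset.mem_insert.1 hb with rfl | hb
      · refine Finset.mem_filter.2 ⟨Finset.mem_insert_self _ _, ?_⟩
        rcases hmem with hm | hm
        · exact ⟨b, hm, Or.inl rfl⟩
        · exact ⟨v, hm, Or.inl hpar.symm⟩
      · obtain ⟨hbF, a, ha, hab⟩ := Finset.mem_filter.1 hb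
        refine Finset.mem_filter.2 ⟨Finset.mem_insert_of_mem hbF, ?_⟩
        rcases Finset.mem_insert.1 ha with rfl | ha
        · rcases hmem with hm | hm
          · exact ⟨u, hm, htwin b (Finset.mem_of_mem_erase (hF hbF)) hab⟩
          · exact ⟨a, hm, hab⟩
        · exact ⟨a, (hW a ha).2.2, hab⟩
    linarith
  · push Not at hmem
    have hsum := h U fun a ha => Finset.mem_erase.2 ⟨fun h => hmem.1 (h ▸ ha), hU ha⟩
    have hcongr : ∑ a ∈ U, L a * Function.update y v (y u + y v - 1) a = ∑ a ∈ U, L a * y a :=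
      Finset.sum_congr rfl fun a ha => by
        rw [Function.update_of_ne (ne_of_mem_of_not_mem ha hmem.2)]
    rw [hcongr] at hsum
    refine hsum.trans (Finset.sum_le_sum_of_subset_of_nonneg ?_ fun i _ _ => hL i)
    exact Finset.filter_subset_filter _ (Finset.subset_insert _ _)

theorem covers_of_swap {V : Type*} {par : V → V} {N F F' : Finset V} {L y : V → ℝ} {u v : V}
    (hL : ∀ a, 0 ≤ L a) (huv : u ≠ v) (hyu : 0 ≤ y u) (hyu' : y u ≤ 1)
    (hyv : y v = 1) (hF : F ⊆ N.erase u) (hpar : par u = v) (hFF' : F ⊆ F')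
    (hmax : (v ∈ F ∧ u ∈ F') ∨ v ∉ F ∧
      ((v ∈ F' ∧ L u ≤ L v) ∨ (u ∈ F' ∧ L v ≤ L u)))
    (h : Covers par (N.erase u) (Function.update L v (min (L u) (L v)))
      (Function.update y v (y u)) F) :
    Covers par N L y F' := by
  intro U hU
  have hsum := h (U.erase u) (Finset.erase_subset_erase _ hU)
  have hW : ∀ a ∈ U \ {u, v}, a ≠ u ∧ a ≠ v ∧ a ∈ U := by
    intro a ha
    simp only [Finset.mem_sdiff, Finset.mem_insert, Finset.mem_singleton, not_or] at ha
    tauto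
  by_cases hmem : u ∈ U ∨ v ∈ U
  · have hleft : ∑ a ∈ U, L a * y a ≤ max (L u) (L v) + ∑ a ∈ U.erase u,
        Function.update L v (min (L u) (L v)) a * Function.update y v (y u) a := by
      have hcongr : ∑ a ∈ U \ {u, v},
          Function.update L v (min (L u) (L v)) a * Function.update y v (y u) a
          = ∑ a ∈ U \ {u, v}, L a * y a :=
        Finset.sum_congr rfl fun a ha => by
          rw [Function.update_of_ne (hW a ha).2.1, Function.update_of_ne (hW a ha).2.1]
      by_cases hv : v ∈ U
      · have hset : U.erase u = insert v (U \ {u, v}) := by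
          ext a; simp only [Finset.mem_erase, Finset.mem_insert, Finset.mem_sdiff,
            Finset.mem_singleton]
          by_cases hav : a = v
          · subst hav; simp [hv, huv.symm]
          · simp [hav]; tauto
        rw [hset, Finset.sum_insert (by simp), hcongr, Function.update_self, Function.update_self]
        have hpair := sum_le_pair_add_sum_sdiff U (fun a => L a * y a) huv
          (mul_nonneg (hL u) hyu) (mul_nonneg (hL v) (by rw [hyv]; exact zero_le_one))
        simp only [hyv, mul_one] at hpair
        rcases le_total (L u) (L v) with hle | hle
        · rw [max_eq_right hle, min_eq_left hle]; linarith
        · rw [max_eq_left hle, min_eq_right hle]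
          have := mul_le_mul_of_nonneg_right hle (sub_nonneg.2 hyu')
          linarith
      · have hu : u ∈ U := hmem.resolve_right hv
        have hset : U.erase u = U \ {u, v} := by
          ext a; simp only [Finset.mem_erase, Finset.mem_insert, Finset.mem_sdiff,
            Finset.mem_singleton]
          have : a ∈ U → a ≠ v := fun h h' => hv (h' ▸ h)
          tauto
        rw [hset, hcongr, ← hset, ← Finset.add_sum_erase U _ hu]
        gcongr
        exact (mul_le_of_le_one_right (hL u) hyu').trans (le_max_left _ _)
    have hnear : ∀ c, c = u ∨ c = v → ∃ a ∈ U, Near par a c := by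
      rintro c (rfl | rfl) <;> rcases hmem with hm | hm
      · exact ⟨c, hm, Or.inl rfl⟩
      · exact ⟨v, hm, Or.inr (Or.inr (Or.inl hpar))⟩
      · exact ⟨u, hm, Or.inr (Or.inl hpar)⟩
      · exact ⟨c, hm, Or.inl rfl⟩
    set R := {b ∈ F | ∃ a ∈ U.erase u, Near par a b} with hR
    have hRF : ∀ b ∈ R, b ∈ F ∧ b ≠ u ∧ ∃ a ∈ U, Near par a b := by
      intro b hb
      obtain ⟨hb, a, ha, hab⟩ := Finset.mem_filter.1 hb
      exact ⟨hb, Finset.ne_of_mem_erase (hF hb), a, Finset.mem_of_mem_erase ha, hab⟩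
    have hRv : ∑ b ∈ R.erase v, Function.update L v (min (L u) (L v)) b = ∑ b ∈ R.erase v, L b :=
      Finset.sum_congr rfl fun b hb => Function.update_of_ne (Finset.ne_of_mem_erase hb) _ _
    have hsub : ∀ T : Finset V, T ⊆ F' → (∀ b ∈ T, b = u ∨ b = v ∨ b ∈ R) →
        ∑ b ∈ T, L b ≤ ∑ b ∈ F' with ∃ a ∈ U, Near par a b, L b := by
      intro T hT hTR
      refine Finset.sum_le_sum_of_subset_of_nonneg ?_ fun i _ _ => hL i
      intro b hb
      refine Finset.mem_filter.2 ⟨hT hb, ?_⟩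
      rcases hTR b hb with h | h | h
      · exact hnear b (Or.inl h)
      · exact hnear b (Or.inr h)
      · exact (hRF b h).2.2
    have hright : max (L u) (L v) + ∑ b ∈ R, Function.update L v (min (L u) (L v)) b
        ≤ ∑ b ∈ F' with ∃ a ∈ U, Near par a b, L b := by
      have huR : u ∉ R := fun hu => (hRF u hu).2.1 rfl
      have hRF' : ∀ b ∈ R, b ∈ F' := fun b hb => hFF' (hRF b hb).1
      rcases hmax with ⟨hvF, huF'⟩ | ⟨hvF, hmax⟩
      · have h1 := hsub (insert u (insert v (R.erase v))) (by
          simp only [Finset.insert_subset_iff]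
          exact ⟨huF', hFF' hvF, fun b hb => hRF' b (Finset.mem_of_mem_erase hb)⟩) (by
          intro b hb
          simp only [Finset.mem_insert, Finset.mem_erase] at hb
          tauto)
        rw [Finset.sum_insert (by simp [huv, huR]), Finset.sum_insert (by simp)] at h1
        have h2 : ∑ b ∈ R, Function.update L v (min (L u) (L v)) b
            ≤ min (L u) (L v) + ∑ b ∈ R.erase v, L b := by
          by_cases hvR : v ∈ R
          · rw [← Finset.add_sum_erase R _ hvR, hRv, Function.update_self]
          · rw [← hRv, Finset.erase_eq_of_notMem hvR]
            have : 0 ≤ min (L u) (L v) := le_min (hL u) (hL v)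
            linarith
        have := max_add_min (L u) (L v)
        linarith
      · have hvR : v ∉ R := fun hv => hvF (hRF v hv).1
        rw [Finset.erase_eq_of_notMem hvR] at hRv
        rw [hRv]
        rcases hmax with ⟨hvF', hle⟩ | ⟨huF', hle⟩
        · rw [max_eq_right hle, ← Finset.sum_insert hvR]
          refine hsub _ (Finset.insert_subset hvF' hRF') fun b hb => ?_
          rcases Finset.mem_insert.1 hb with h | h <;> tauto
        · rw [max_eq_left hle, ← Finset.sum_insert huR]
          refine hsub _ (Finset.insert_subset huF' hRF') fun b hb => ?_
          rcases Finset.mem_insert.1 hb with h | h <;> tauto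
    linarith
  · push Not at hmem
    rw [Finset.erase_eq_of_notMem hmem.1] at hsum
    have hcongr : ∑ a ∈ U, Function.update L v (min (L u) (L v)) a * Function.update y v (y u) a
        = ∑ a ∈ U, L a * y a :=
      Finset.sum_congr rfl fun a ha => by
        have : a ≠ v := fun h => hmem.2 (h ▸ ha)
        rw [Function.update_of_ne this, Function.update_of_ne this]
    rw [hcongr] at hsum
    refine hsum.trans ((Finset.sum_le_sum (g := L) fun b _ => ?_).trans
      (Finset.sum_le_sum_of_subset_of_nonneg (Finset.filter_subset_filter _ hFF')
        fun i _ _ => hL i))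
    by_cases hb : b = v
    · subst hb; simp
    · rw [Function.update_of_ne hb]

theorem near_of_twin {V : Type*} {par : V → V} {N : Finset V} {r u v b : V} (hr : par r = r)
    (hN : ∀ a ∈ N, a ≠ r → par a ∈ N) (hur : u ≠ r)
    (hu : ∀ c ∈ N, c ≠ r → par c ≠ u) (hpar : par u = par v) (hb : b ∈ N)
    (h : Near par u b) : Near par v b := by
  have hchild : ∀ c ∈ N, par c ≠ u := by
    intro c hc
    by_cases hcr : c = r
    · rw [hcr, hr]; exact hur.symm
    · exact hu c hc hcr
  rcases h with h | h | h | h | h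
  · exact Or.inl (hpar ▸ h)
  · exact Or.inr (Or.inl (hpar ▸ h))
  · exact absurd h (hchild b hb)
  · exact Or.inr (Or.inr (Or.inr (Or.inl (hpar ▸ h))))
  · by_cases hbr : b = r
    · rw [hbr, hr, hr] at h
      exact absurd h.symm hur
    · exact absurd h (hchild _ (hN b hb hbr))

/-- A fractional opening of a rooted tree with integral total value, in which every internal
vertex is completely open, can be rounded so that capacity moves by at most two tree edges. -/
theorem exists_covers_of_tree {V : Type*} (par : V → V) (r : V) (depth : V → ℕ)
    (hr : par r = r) (n : ℕ) : ∀ (N : Finset V) (L y : V → ℝ) (k : ℕ), N.card = n →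
      (∀ v ∈ N, v ≠ r → par v ∈ N ∧ depth (par v) < depth v) →
      (∀ v, 0 ≤ L v) → (∀ v ∈ N, 0 ≤ y v ∧ y v ≤ 1) →
      (∀ v ∈ N, v ≠ r → y (par v) = 1) → ∑ v ∈ N, y v = k →
      ∃ F ⊆ N, F.card = k ∧ Covers par N L y F := by
  induction n with
  | zero =>
    intro N L y k hcard _ _ _ _ hsum
    rw [Finset.card_eq_zero] at hcard
    subst hcard
    refine ⟨∅, le_rfl, by simpa [eq_comm] using hsum, fun U hU => ?_⟩
    simp [Finset.subset_empty.1 hU]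
  | succ n ih =>
    intro N L y k hcard hN hL hy hint hsum
    by_cases hI : (N.filter (· ≠ r)).Nonempty
    · obtain ⟨v₀, hv₀, hmax⟩ := Finset.exists_max_image ((N.filter (· ≠ r)).image par) depth
        (hI.image par)
      obtain ⟨u₀, hu₀, rfl⟩ := Finset.mem_image.1 hv₀
      obtain ⟨hu₀N, hu₀r⟩ := Finset.mem_filter.1 hu₀
      have hchildless : ∀ u ∈ N, u ≠ r → par u = par u₀ → ∀ c ∈ N, c ≠ r → par c ≠ u := by
        intro u hu hur hpu c hc hcr hcu
        have h1 := hmax (par c) (Finset.mem_image_of_mem _ (Finset.mem_filter.2 ⟨hc, hcr⟩))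
        have h2 := (hN u hu hur).2
        rw [hpu] at h2
        rw [hcu] at h1
        omega
      by_cases hsib : ∃ u ∈ N, u ≠ r ∧ par u = par u₀ ∧ u ≠ u₀
      · obtain ⟨u, v, hu, hv, hur, hvr, huv, hpu, hpv, hle⟩ : ∃ u v, u ∈ N ∧ v ∈ N ∧ u ≠ r ∧
            v ≠ r ∧ u ≠ v ∧ par u = par u₀ ∧ par v = par u₀ ∧ L v ≤ L u := by
          obtain ⟨u, hu, hur, hpu, hne⟩ := hsib
          rcases le_total (L u₀) (L u) with h | h
          · exact ⟨u, u₀, hu, hu₀N, hur, hu₀r, hne, hpu, rfl, h⟩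
          · exact ⟨u₀, u, hu₀N, hu, hu₀r, hur, hne.symm, rfl, hpu, h⟩
        have hcu := hchildless u hu hur hpu
        have hcv := hchildless v hv hvr hpv
        have hNpar : ∀ a ∈ N, a ≠ r → par a ∈ N := fun a ha har => (hN a ha har).1
        rcases le_or_gt (y u + y v) 1 with hcase | hcase
        · obtain ⟨F, hF, hFc, hcov⟩ := ih (N.erase v) L (Function.update y u (y u + y v)) k
            (by rw [Finset.card_erase_of_mem hv, hcard]; rfl)
            (fun a ha har => by
              have ha := Finset.mem_of_mem_erase ha
              exact ⟨Finset.mem_erase.2 ⟨hcv a ha har, hNpar a ha har⟩, (hN a ha har).2⟩)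
            hL
            (fun a ha => by
              have ha := Finset.mem_of_mem_erase ha
              by_cases hau : a = u
              · subst hau
                rw [Function.update_self]
                exact ⟨add_nonneg (hy a ha).1 (hy v hv).1, hcase⟩
              · rw [Function.update_of_ne hau]; exact hy a ha)
            (fun a ha har => by
              have ha := Finset.mem_of_mem_erase ha
              rw [Function.update_of_ne (hcu a ha har)]
              exact hint a ha har)
            (by
              have hu' : u ∈ N.erase v := Finset.mem_erase.2 ⟨huv, hu⟩
              rw [Finset.sum_update_of_mem hu', Finset.sdiff_singleton_eq_erase, ← hsum,
                ← Finset.add_sum_erase N _ hv, ← Finset.add_sum_erase _ _ hu']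
              ring)
          refine ⟨F, hF.trans (Finset.erase_subset _ _), hFc, ?_⟩
          exact covers_of_merge hL hu huv (hy u hu).1 (hy v hv).1 hle
            (hF.trans (Finset.erase_subset _ _))
            (fun b hb => near_of_twin hr hNpar hur hcu (hpu.trans hpv.symm) hb) hcov
        · have hv' : v ∈ N.erase u := Finset.mem_erase.2 ⟨huv.symm, hv⟩
          have hsum' : ∑ a ∈ N.erase u, Function.update y v (y u + y v - 1) a = (k : ℝ) - 1 := by
            rw [Finset.sum_update_of_mem hv', Finset.sdiff_singleton_eq_erase, ← hsum,
              ← Finset.add_sum_erase N _ hu, ← Finset.add_sum_erase _ _ hv']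
            ring
          have hy' : ∀ a ∈ N.erase u, 0 ≤ Function.update y v (y u + y v - 1) a ∧
              Function.update y v (y u + y v - 1) a ≤ 1 := by
            intro a ha
            have ha := Finset.mem_of_mem_erase ha
            by_cases hav : a = v
            · subst hav
              rw [Function.update_self]
              constructor <;> linarith [hy u hu, hy a ha]
            · rw [Function.update_of_ne hav]; exact hy a ha
          have hk : 1 ≤ k := by
            have : (0 : ℝ) ≤ k - 1 := hsum' ▸ Finset.sum_nonneg fun a ha => (hy' a ha).1
            exact_mod_cast sub_nonneg.1 this
          obtain ⟨F, hF, hFc, hcov⟩ := ih (N.erase u) L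
            (Function.update y v (y u + y v - 1)) (k - 1)
            (by rw [Finset.card_erase_of_mem hu, hcard]; rfl)
            (fun a ha har => by
              have ha := Finset.mem_of_mem_erase ha
              exact ⟨Finset.mem_erase.2 ⟨hcu a ha har, hNpar a ha har⟩, (hN a ha har).2⟩)
            hL hy'
            (fun a ha har => by
              have ha := Finset.mem_of_mem_erase ha
              rw [Function.update_of_ne (hcv a ha har)]
              exact hint a ha har)
            (by rw [hsum', Nat.cast_sub hk, Nat.cast_one])
          have huF : u ∉ F := fun h => Finset.notMem_erase u N (hF h)
          refine ⟨insert u F, Finset.insert_subset hu (hF.trans (Finset.erase_subset _ _)), ?_, ?_⟩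
          · rw [Finset.card_insert_of_notMem huF, hFc]; omega
          · exact covers_insert_of_open hL hv huv (hy u hu).1 (hy u hu).2 (hy v hv).1 hle hF
              (hpu.trans hpv.symm)
              (fun b hb => near_of_twin hr hNpar hvr hcv (hpv.trans hpu.symm) hb) hcov
      · push Not at hsib
        obtain ⟨v, hpv⟩ : ∃ v, par u₀ = v := ⟨_, rfl⟩
        have hv : v ∈ N := hpv ▸ (hN u₀ hu₀N hu₀r).1
        have hyv : y v = 1 := hpv ▸ hint u₀ hu₀N hu₀r
        have huv : u₀ ≠ v := by
          intro h
          have := (hN u₀ hu₀N hu₀r).2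
          rw [hpv, ← h] at this
          exact lt_irrefl _ this
        have hcu := hchildless u₀ hu₀N hu₀r rfl
        have hcv : ∀ a ∈ N.erase u₀, a ≠ r → par a ≠ v := by
          intro a ha har h
          obtain ⟨hne, ha⟩ := Finset.mem_erase.1 ha
          exact hne (hsib a ha har (h.trans hpv.symm))
        have hv' : v ∈ N.erase u₀ := Finset.mem_erase.2 ⟨huv.symm, hv⟩
        have hsum' : ∑ a ∈ N.erase u₀, Function.update y v (y u₀) a = (k : ℝ) - 1 := by
          rw [Finset.sum_update_of_mem hv', Finset.sdiff_singleton_eq_erase, ← hsum,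
            ← Finset.add_sum_erase N _ hu₀N, ← Finset.add_sum_erase _ _ hv', hyv]
          ring
        have hy' : ∀ a ∈ N.erase u₀, 0 ≤ Function.update y v (y u₀) a ∧
            Function.update y v (y u₀) a ≤ 1 := by
          intro a ha
          by_cases hav : a = v
          · subst hav
            rw [Function.update_self]
            exact hy u₀ hu₀N
          · rw [Function.update_of_ne hav]; exact hy a (Finset.mem_of_mem_erase ha)
        have hk : 1 ≤ k := by
          have : (0 : ℝ) ≤ k - 1 := hsum' ▸ Finset.sum_nonneg fun a ha => (hy' a ha).1
          exact_mod_cast sub_nonneg.1 this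
        obtain ⟨F, hF, hFc, hcov⟩ := ih (N.erase u₀)
          (Function.update L v (min (L u₀) (L v))) (Function.update y v (y u₀)) (k - 1)
          (by rw [Finset.card_erase_of_mem hu₀N, hcard]; rfl)
          (fun a ha har => by
            have ha := Finset.mem_of_mem_erase ha
            exact ⟨Finset.mem_erase.2 ⟨hcu a ha har, (hN a ha har).1⟩, (hN a ha har).2⟩)
          (fun a => by
            by_cases hav : a = v
            · subst hav
              rw [Function.update_self]
              exact le_min (hL _) (hL _)
            · rw [Function.update_of_ne hav]; exact hL a)
          hy'
          (fun a ha har => by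
            rw [Function.update_of_ne (hcv a ha har)]
            exact hint a (Finset.mem_of_mem_erase ha) har)
          (by rw [hsum', Nat.cast_sub hk, Nat.cast_one])
        have huF : u₀ ∉ F := fun h => Finset.notMem_erase u₀ N (hF h)
        have hFN := hF.trans (Finset.erase_subset _ _)
        obtain ⟨e, he, heN, heF⟩ : ∃ e, ((v ∈ F ∧ e = u₀) ∨ v ∉ F ∧
            ((e = v ∧ L u₀ ≤ L v) ∨ (e = u₀ ∧ L v ≤ L u₀))) ∧ e ∈ N ∧ e ∉ F := by
          by_cases hvF : v ∈ F
          · exact ⟨u₀, Or.inl ⟨hvF, rfl⟩, hu₀N, huF⟩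
          · rcases le_total (L u₀) (L v) with h | h
            · exact ⟨v, Or.inr ⟨hvF, Or.inl ⟨rfl, h⟩⟩, hv, hvF⟩
            · exact ⟨u₀, Or.inr ⟨hvF, Or.inr ⟨rfl, h⟩⟩, hu₀N, huF⟩
        refine ⟨insert e F, Finset.insert_subset heN hFN, ?_, ?_⟩
        · rw [Finset.card_insert_of_notMem heF, hFc]; omega
        · refine covers_of_swap hL huv (hy _ hu₀N).1 (hy _ hu₀N).2 hyv hF hpv
            (Finset.subset_insert _ _) ?_ hcov
          simp only [Finset.mem_insert]
          rcases he with ⟨h1, rfl⟩ | ⟨h1, ⟨rfl, h2⟩ | ⟨rfl, h2⟩⟩ <;> tauto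
    · have hall : ∀ a ∈ N, a = r := by
        intro a ha
        by_contra har
        exact hI ⟨a, Finset.mem_filter.2 ⟨ha, har⟩⟩
      have hNr : N = {r} := by
        refine Finset.eq_singleton_iff_unique_mem.2 ⟨?_, hall⟩
        obtain ⟨a, ha⟩ := Finset.card_pos.1 (by omega : 0 < N.card)
        exact hall a ha ▸ ha
      subst hNr
      rw [Finset.sum_singleton] at hsum
      have hk : k ≤ 1 := by
        have := (hy r (Finset.mem_singleton_self r)).2
        rw [hsum] at this
        exact_mod_cast this
      rcases Nat.le_one_iff_eq_zero_or_eq_one.1 hk with rfl | rfl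
      · refine ⟨∅, Finset.empty_subset _, rfl, fun U hU => ?_⟩
        rcases Finset.subset_singleton_iff.1 hU with rfl | rfl <;> simp [hsum]
      · refine ⟨{r}, le_rfl, rfl, fun U hU => ?_⟩
        rcases Finset.subset_singleton_iff.1 hU with rfl | rfl
        · simp
        · rw [Finset.filter_true_of_mem]
          · simp [hsum]
          · intro b hb
            exact ⟨b, hb, Or.inl rfl⟩

/-- A deficiency version of Hall's theorem for assignments of clients to capacitated
facilities. -/
theorem exists_assignment_of_hall {V : Type*} (Cs F : Finset V) (L : V → ℕ) (p : ℕ)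
    (E : V → V → Prop)
    (h : ∀ X ⊆ Cs, p ≤ (Cs \ X).card + ∑ b ∈ F with ∃ v ∈ X, E v b, L b) :
    ∃ C ⊆ Cs, ∃ φ : V → V, C.card = p ∧ (∀ v ∈ C, φ v ∈ F ∧ E v (φ v)) ∧
      ∀ u ∈ F, {v ∈ C | φ v = u}.card ≤ L u := by
  have hp : p ≤ Cs.card := by simpa using h ∅ (Finset.empty_subset _)
  let slots : Finset V → Finset ((Σ _ : V, ℕ) ⊕ ℕ) := fun B =>
    (B.sigma fun b => Finset.range (L b)).disjSum (Finset.range (Cs.card - p))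
  let t : Cs → Finset ((Σ _ : V, ℕ) ⊕ ℕ) := fun v => slots {b ∈ F | E v b}
  obtain ⟨f, hf, hft⟩ := (Finset.all_card_le_biUnion_card_iff_exists_injective t).1 (by
    intro X
    rcases X.eq_empty_or_nonempty with rfl | ⟨v₀, hv₀⟩
    · simp
    have hX : X.map (Function.Embedding.subtype _) ⊆ Cs := by
      intro v hv
      obtain ⟨w, _, rfl⟩ := Finset.mem_map.1 hv
      exact w.2
    have h1 := h _ hX
    have h2 := Finset.card_sdiff_add_card_eq_card hX
    rw [Finset.card_map] at h2
    have h3 : slots {b ∈ F | ∃ v ∈ X.map (Function.Embedding.subtype _), E v b}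
        ⊆ X.biUnion t := by
      intro z hz
      rw [Finset.mem_biUnion]
      rcases z with ⟨b, i⟩ | j
      · simp only [slots, Finset.inl_mem_disjSum, Finset.mem_sigma, Finset.mem_filter] at hz
        obtain ⟨⟨hb, v, hv, hvb⟩, hi⟩ := hz
        obtain ⟨w, hw, rfl⟩ := Finset.mem_map.1 hv
        refine ⟨w, hw, ?_⟩
        simp only [t, slots, Finset.inl_mem_disjSum, Finset.mem_sigma, Finset.mem_filter]
        exact ⟨⟨hb, hvb⟩, hi⟩
      · refine ⟨v₀, hv₀, ?_⟩
        simpa [t, slots] using hz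
    have h4 := Finset.card_le_card h3
    simp only [slots, Finset.card_disjSum, Finset.card_sigma, Finset.card_range] at h4
    omega)
  have hfl : ∀ v : Cs, ∀ z, f v = Sum.inl z → z.1 ∈ F ∧ E v z.1 ∧ z.2 < L z.1 := by
    intro v z hz
    have := hft v
    rw [hz] at this
    simp only [t, slots, Finset.inl_mem_disjSum, Finset.mem_sigma, Finset.mem_filter,
      Finset.mem_range] at this
    exact ⟨this.1.1, this.1.2, this.2⟩
  let A : Finset Cs := {v | (f v).isLeft}
  have hA : p ≤ A.card := by
    have h1 : (Finset.univ.filter fun v : Cs => ¬ (f v).isLeft).card ≤ Cs.card - p := by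
      rw [← Finset.card_range (Cs.card - p),
        ← Finset.card_map (Function.Embedding.inr : ℕ ↪ (Σ _ : V, ℕ) ⊕ ℕ)]
      refine Finset.card_le_card_of_injOn f ?_ hf.injOn
      intro v hv
      have hv := (Finset.mem_filter.1 hv).2
      have hm := hft v
      rcases hz : f v with z | j
      · simp [hz] at hv
      · rw [hz] at hm
        simpa [t, slots] using hm
    have h2 := Finset.card_filter_add_card_filter_not (s := (Finset.univ : Finset Cs))
      (fun v => ((f v).isLeft : Prop))
    rw [Finset.card_univ, Fintype.card_coe] at h2
    change p ≤ (Finset.univ.filter fun v : Cs => (f v).isLeft).card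
    omega
  obtain ⟨A', hA', hcard⟩ := Finset.exists_subset_card_eq hA
  let φ : V → V := fun v => if hv : v ∈ Cs then
    Sum.elim (fun z => z.1) (fun _ => v) (f ⟨v, hv⟩) else v
  have hφ : ∀ v ∈ A', ∃ i, f v = Sum.inl ⟨φ v, i⟩ := by
    intro v hv
    obtain ⟨⟨b, i⟩, hz⟩ := Sum.isLeft_iff.1 (Finset.mem_filter.1 (hA' hv)).2
    exact ⟨i, by simp [φ, hz]⟩
  refine ⟨A'.map (Function.Embedding.subtype _), ?_, φ, by rw [Finset.card_map, hcard], ?_, ?_⟩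
  · intro v hv
    obtain ⟨w, _, rfl⟩ := Finset.mem_map.1 hv
    exact w.2
  · intro v hv
    obtain ⟨w, hw, rfl⟩ := Finset.mem_map.1 hv
    obtain ⟨i, hi⟩ := hφ w hw
    have := hfl w _ hi
    exact ⟨this.1, this.2.1⟩
  · intro u _
    rw [← Finset.card_range (L u),
      ← Finset.card_map (⟨fun i => Sum.inl ⟨u, i⟩, fun i j hij => by simpa using hij⟩ :
        ℕ ↪ (Σ _ : V, ℕ) ⊕ ℕ), Finset.filter_map, Finset.card_map]
    refine Finset.card_le_card_of_injOn f ?_ hf.injOn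
    intro v hv
    obtain ⟨hv, hvu⟩ := Finset.mem_filter.1 hv
    obtain ⟨i, hi⟩ := hφ v hv
    have hlt := (hfl v _ hi).2.2
    have hvu : φ v = u := hvu
    rw [hvu] at hi hlt
    rw [hi]
    exact Finset.mem_map.2 ⟨i, Finset.mem_range.2 hlt, rfl⟩

/-- One unit of a fractional opening can be gathered at a vertex of maximum capacity of `B`. -/
theorem exists_gather {V : Type*} (A B : Finset V) (m : V) (L y : V → ℝ) (hBA : B ⊆ A)
    (hm : m ∈ B) (hL : ∀ a, 0 ≤ L a) (hmax : ∀ b ∈ B, L b ≤ L m)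
    (hy : ∀ a, 0 ≤ y a ∧ y a ≤ 1) (hB : 1 ≤ ∑ b ∈ B, y b) :
    ∃ y' : V → ℝ, (∀ a, 0 ≤ y' a ∧ y' a ≤ 1) ∧ y' m = 1 ∧ ∑ a ∈ A, y' a = ∑ a ∈ A, y a ∧
      (∀ U ⊆ A, Disjoint U B → ∑ a ∈ U, L a * y a = ∑ a ∈ U, L a * y' a) ∧
      ∀ U ⊆ A, ∑ a ∈ U, L a * y a ≤ ∑ a ∈ insert m U, L a * y' a := by
  obtain ⟨c, hc0, hc1, hc⟩ : ∃ c : ℝ, 0 ≤ c ∧ c ≤ 1 ∧ c * ∑ b ∈ B.erase m, y b = 1 - y m := by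
    rw [← Finset.add_sum_erase B y hm] at hB
    have hm1 := (hy m).2
    rcases (Finset.sum_nonneg fun b (_ : b ∈ B.erase m) => (hy b).1).eq_or_lt with h0 | h0
    · exact ⟨0, le_rfl, zero_le_one, by linarith⟩
    · exact ⟨(1 - y m) / ∑ b ∈ B.erase m, y b, div_nonneg (by linarith) h0.le,
        (div_le_one h0).2 (by linarith), div_mul_cancel₀ _ h0.ne'⟩
  let δ : V → ℝ := fun a => if a ∈ B.erase m then c * y a else 0
  have hδ0 : ∀ a, 0 ≤ δ a := fun a => by
    dsimp only [δ]; split_ifs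
    · exact mul_nonneg hc0 (hy a).1
    · exact le_rfl
  have hδy : ∀ a, δ a ≤ y a := fun a => by
    dsimp only [δ]; split_ifs
    · exact mul_le_of_le_one_left (hy a).1 hc1
    · exact (hy a).1
  have hδsum : ∀ U : Finset V, B.erase m ⊆ U → ∑ a ∈ U, δ a = 1 - y m := by
    intro U hU
    rw [← hc, Finset.mul_sum, Finset.sum_ite_mem, Finset.inter_eq_right.2 hU]
  have hBAm : B.erase m ⊆ A.erase m := Finset.erase_subset_erase _ hBA
  have hne : ∀ U : Finset V, ∀ g : V → ℝ, ∑ a ∈ U.erase m, g a * Function.update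
      (fun a => y a - δ a) m 1 a = ∑ a ∈ U.erase m, g a * (y a - δ a) := fun U g =>
    Finset.sum_congr rfl fun a ha => by rw [Function.update_of_ne (Finset.ne_of_mem_erase ha)]
  refine ⟨Function.update (fun a => y a - δ a) m 1, fun a => ?_, Function.update_self _ _ _, ?_,
    fun U _ hUB => ?_, fun U hU => ?_⟩
  · by_cases ha : a = m
    · subst ha; rw [Function.update_self]; exact ⟨zero_le_one, le_rfl⟩
    · rw [Function.update_of_ne ha]
      exact ⟨sub_nonneg.2 (hδy a), (sub_le_self _ (hδ0 a)).trans (hy a).2⟩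
  · have h1 := hne A fun _ => 1
    simp only [one_mul] at h1
    rw [← Finset.add_sum_erase A _ (hBA hm), h1, Function.update_self, Finset.sum_sub_distrib,
      hδsum _ hBAm, ← Finset.add_sum_erase A y (hBA hm)]
    ring
  · refine Finset.sum_congr rfl fun a ha => ?_
    have haB : a ∉ B := Finset.disjoint_left.1 hUB ha
    rw [Function.update_of_ne (ne_of_mem_of_not_mem hm haB).symm]
    simp [δ, haB]
  · have h1 : ∑ a ∈ U, L a * y a ≤ L m * y m + ∑ a ∈ U.erase m, L a * y a := by
      by_cases hmU : m ∈ U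
      · rw [← Finset.add_sum_erase U _ hmU]
      · rw [Finset.erase_eq_of_notMem hmU]
        exact le_add_of_nonneg_left (mul_nonneg (hL m) (hy m).1)
    have h2 : ∑ a ∈ U.erase m, L a * δ a ≤ L m * (1 - y m) := by
      rw [← hδsum _ hBAm, Finset.mul_sum]
      refine (Finset.sum_le_sum fun a _ => ?_).trans (Finset.sum_le_sum_of_subset_of_nonneg
        (Finset.erase_subset_erase _ hU) fun a _ _ => mul_nonneg (hL m) (hδ0 a))
      by_cases ha : a ∈ B.erase m
      · exact mul_le_mul_of_nonneg_right (hmax a (Finset.mem_of_mem_erase ha)) (hδ0 a)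
      · simp only [δ, if_neg ha, mul_zero, le_refl]
    rw [← Finset.add_sum_erase _ _ (Finset.mem_insert_self m U), Finset.erase_insert_eq_erase,
      hne U L, Function.update_self]
    simp only [mul_sub, Finset.sum_sub_distrib]
    linarith

theorem exists_parent_of_reachable {V : Type*} (H : SimpleGraph V) (S : Finset V) (r : V)
    (hS : ∀ a b, H.Adj a b → b ∈ S) (hreach : ∀ s ∈ S, H.Reachable s r) :
    ∃ π : V → V, ∀ s ∈ S, s ≠ r → π s ∈ S ∧ H.Adj s (π s) ∧ H.dist (π s) r < H.dist s r := by
  have : ∀ s, ∃ t, s ∈ S → s ≠ r → t ∈ S ∧ H.Adj s t ∧ H.dist t r < H.dist s r := by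
    intro s
    by_cases hs : s ∈ S ∧ s ≠ r
    · obtain ⟨q, hq⟩ := (hreach s hs.1).exists_walk_length_eq_dist
      cases q with
      | nil => exact absurd rfl hs.2
      | cons hadj q =>
        refine ⟨_, fun _ _ => ⟨hS _ _ hadj, hadj, ?_⟩⟩
        have := H.dist_le q
        rw [SimpleGraph.Walk.length_cons] at hq
        omega
    · exact ⟨s, fun h1 h2 => absurd ⟨h1, h2⟩ hs⟩
  choose π hπ using this
  exact ⟨π, hπ⟩

theorem IsGraphicInstance.even_dist {V : Type*} [Fintype V] {G : SimpleGraph V}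
    {Cs Fs : Finset V} (h : IsGraphicInstance G Cs Fs) (hG : G.Connected) {u v : V}
    (hu : u ∈ Fs) (hv : v ∈ Fs) : Even (G.dist u v) := by
  let c : G.Coloring Bool := SimpleGraph.Coloring.mk (fun v => decide (v ∈ Fs)) (by
    intro a b hab
    rcases h.2.2 a b hab with ⟨ha, hb⟩ | ⟨ha, hb⟩
    · simp [hb, Finset.disjoint_left.1 h.1 ha]
    · simp [ha, Finset.disjoint_left.1 h.1 hb])
  obtain ⟨q, hq⟩ := hG.exists_walk_length_eq_dist u v
  rw [← hq, c.even_length_iff_congr q]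
  change decide (u ∈ Fs) = true ↔ decide (v ∈ Fs) = true
  simp [hu, hv]

/-- A feasible LP solution together with a facility set capturing all fractional capacity
within distance `τ` yields a distance-`τ + 1` solution. -/
theorem LPSat.exists_isSolution {V : Type*} [Fintype V] [DecidableEq V] {G : SimpleGraph V}
    {Cs Fs : Finset V} {L : V → ℕ} {k p : ℕ} {S : Finset V} {x : V → V → ℝ} {y : V → ℝ}
    (h : LPSat G Cs Fs L k p S x y) (hG : G.Connected) {τ : ℕ} {F : Finset V} (hF : F ⊆ Fs)
    (hcard : F.card = k)
    (hcap : ∀ T ⊆ Fs, ∑ u ∈ T, (L u : ℝ) * y u ≤ ∑ b ∈ F with ∃ u ∈ T, G.dist u b ≤ τ, (L b : ℝ)) :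
    ∃ C F φ, IsSolution G Cs Fs L k p (τ + 1) C F φ := by
  obtain ⟨-, hx, -, hxsum, -, hxL, hx1, -, hx0⟩ := h
  obtain ⟨C, hC, φ, hCp, hφ, hφL⟩ := exists_assignment_of_hall Cs F L p
    (fun v b => G.dist v b ≤ τ + 1) (by
      intro X hX
      have h1 : ∑ v ∈ Cs \ X, ∑ u ∈ Fs, x u v ≤ ((Cs \ X).card : ℝ) := by
        rw [← nsmul_one, ← Finset.sum_const]
        exact Finset.sum_le_sum fun v hv => hx1 v (Finset.mem_sdiff.1 hv).1
      have h2 : ∑ v ∈ X, ∑ u ∈ Fs, x u v ≤ ∑ u ∈ Fs with ∃ v ∈ X, G.Adj v u, (L u : ℝ) * y u := by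
        rw [Finset.sum_comm, Finset.sum_filter]
        refine Finset.sum_le_sum fun u hu => ?_
        split_ifs with hadj
        · exact (Finset.sum_le_sum_of_subset_of_nonneg hX fun v _ _ => (hx u v).1).trans (hxL u hu)
        · push Not at hadj
          exact (Finset.sum_eq_zero fun v hv => hx0 u hu v (hX hv) (hadj v hv)).le
      have h3 := hcap _ (Finset.filter_subset (fun u => ∃ v ∈ X, G.Adj v u) Fs)
      have h4 : ∑ b ∈ F with ∃ u ∈ Fs.filter (fun u => ∃ v ∈ X, G.Adj v u), G.dist u b ≤ τ,
          (L b : ℝ) ≤ ∑ b ∈ F with ∃ v ∈ X, G.dist v b ≤ τ + 1, (L b : ℝ) := by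
        refine Finset.sum_le_sum_of_subset_of_nonneg ?_ fun b _ _ => Nat.cast_nonneg _
        intro b hb
        obtain ⟨hb, u, hu, hub⟩ := Finset.mem_filter.1 hb
        obtain ⟨v, hv, hvu⟩ := (Finset.mem_filter.1 hu).2
        have htri := hG.dist_triangle (u := v) (v := u) (w := b)
        have hone := SimpleGraph.dist_eq_one_iff_adj.2 hvu
        exact Finset.mem_filter.2 ⟨hb, v, hv, by omega⟩
      have h5 : ∑ v ∈ Cs, ∑ u ∈ Fs, x u v = (p : ℝ) := by rw [Finset.sum_comm, hxsum]
      rw [← Finset.sum_sdiff hX] at h5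
      have h6 : (p : ℝ) ≤ ((Cs \ X).card : ℝ) +
          ∑ b ∈ F with ∃ v ∈ X, G.dist v b ≤ τ + 1, (L b : ℝ) := by linarith
      convert (show p ≤ (Cs \ X).card + ∑ b ∈ F with ∃ v ∈ X, G.dist v b ≤ τ + 1, L b by
        exact_mod_cast h6))
  refine ⟨C, F, φ, hC, hF, hCp, hcard, fun v hv => (hφ v hv).1, fun u hu => ?_, fun v hv => ?_⟩
  · convert hφL u hu
  · rw [← (hG v (φ v)).coe_dist_eq_edist]
    exact_mod_cast (hφ v hv).2

/-- If `G` is connected, the vertices of `S` are pairwise at distance at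
least 6, every vertex is at distance at most 5 from `S`, and `LP_{k,p}(G, L, S)` is
feasible, then the instance admits a distance-25 solution. -/
theorem rounding_25 {V : Type*} [Fintype V] [DecidableEq V]
    (G : SimpleGraph V) (Cs Fs : Finset V) (L : V → ℕ) (k p : ℕ)
    (hinst : IsGraphicInstance G Cs Fs)
    (S : Finset V) (hSF : S ⊆ Fs)
    (hconn : G.Connected)
    (hsep : ∀ u ∈ S, ∀ u' ∈ S, u ≠ u' → 6 ≤ G.edist u u')
    (hcov : ∀ v : V, ∃ s ∈ S, G.edist v s ≤ 5)
    (hLP : LPFeasible G Cs Fs L k p S) :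
    ∃ C F φ, IsSolution G Cs Fs L k p 25 C F φ := by
  obtain ⟨x, y, hLP⟩ := hLP
  have hLPSat := hLP
  obtain ⟨hy, -, hysum, -, -, -, -, hyS, -⟩ := hLP
  have hdist : ∀ u v, G.edist u v = (G.dist u v : ℕ∞) := fun u v =>
    ((hconn u v).coe_dist_eq_edist).symm
  have htri : ∀ a b c, G.dist a c ≤ G.dist a b + G.dist b c := fun _ _ _ => hconn.dist_triangle
  have hcomm : ∀ a b, G.dist a b = G.dist b a := fun _ _ => SimpleGraph.dist_comm
  have htri' : ∀ a b c, G.dist a c ≤ G.dist a b + G.dist c b := fun a b c =>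
    hcomm b c ▸ htri a b c
  have hsep' : ∀ u ∈ S, ∀ u' ∈ S, u ≠ u' → 6 ≤ G.dist u u' := by
    intro u hu u' hu' hne
    have := hsep u hu u' hu' hne
    rw [hdist] at this
    exact_mod_cast this
  have hσ : ∀ v, ∃ s ∈ S, G.dist v s ≤ 5 ∧ ∀ t ∈ S, G.dist v t ≤ 2 → s = t := by
    intro v
    by_cases h : ∃ s ∈ S, G.dist v s ≤ 2
    · obtain ⟨s, hs, hvs⟩ := h
      refine ⟨s, hs, by omega, fun t ht hvt => ?_⟩
      by_contra hne
      have h1 := hsep' s hs t ht hne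
      have h2 := htri s v t
      rw [hcomm s v] at h2
      omega
    · obtain ⟨s, hs, hvs⟩ := hcov v
      rw [hdist] at hvs
      exact ⟨s, hs, by exact_mod_cast hvs, fun t ht hvt => absurd ⟨t, ht, hvt⟩ h⟩
  choose σ hσS hσ5 hσ2 using hσ
  have hσs : ∀ s ∈ S, σ s = s := fun s hs => hσ2 s s hs (by simp)
  obtain ⟨r, hr⟩ : ∃ r, r ∈ S := ⟨_, hσS hconn.nonempty.some⟩
  obtain ⟨π, d, hπ⟩ : ∃ π : V → V, ∃ d : V → ℕ, ∀ s ∈ S, s ≠ r →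
      π s ∈ S ∧ G.dist s (π s) ≤ 10 ∧ d (π s) < d s := by
    let H : SimpleGraph V :=
      { Adj := fun a b => a ∈ S ∧ b ∈ S ∧ a ≠ b ∧ G.dist a b ≤ 10
        symm := ⟨fun a b h => ⟨h.2.1, h.1, h.2.2.1.symm, hcomm a b ▸ h.2.2.2⟩⟩
        loopless := ⟨fun a h => h.2.2.1 rfl⟩ }
    have hadj : ∀ a b, G.Adj a b → H.Reachable (σ a) (σ b) := by
      intro a b hab
      by_cases hne : σ a = σ b
      · rw [hne]
      · refine SimpleGraph.Adj.reachable ⟨hσS a, hσS b, hne, ?_⟩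
        have h1 := htri (σ a) a (σ b)
        have h2 := htri a b (σ b)
        have h3 := SimpleGraph.dist_eq_one_iff_adj.2 hab
        have h4 := hσ5 a
        have h5 := hσ5 b
        rw [hcomm (σ a) a] at h1
        obtain ⟨c, hc⟩ := hinst.even_dist hconn (hSF (hσS a)) (hSF (hσS b))
        omega
    have hwalk : ∀ a b, G.Walk a b → H.Reachable (σ a) (σ b) := by
      intro a b q
      induction q with
      | nil => rfl
      | cons h _ ih => exact (hadj _ _ h).trans ih
    obtain ⟨π, hπ⟩ := exists_parent_of_reachable H S r (fun a b h => h.2.1) (by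
      intro s hs
      obtain ⟨q⟩ := hconn s r
      simpa only [hσs s hs, hσs r hr] using hwalk s r q)
    exact ⟨π, fun s => H.dist s r, fun s hs hsr =>
      ⟨(hπ s hs hsr).1, (hπ s hs hsr).2.1.2.2.2, (hπ s hs hsr).2.2⟩⟩
  let B : V → Finset V := fun s => {u ∈ Fs | G.dist u s ≤ 2}
  have hm : ∀ s, ∃ m, s ∈ S → m ∈ B s ∧ ∀ b ∈ B s, L b ≤ L m := by
    intro s
    by_cases hs : s ∈ S
    · obtain ⟨m, hm⟩ := Finset.exists_max_image (B s) L
        ⟨s, Finset.mem_filter.2 ⟨hSF hs, by simp⟩⟩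
      exact ⟨m, fun _ => hm⟩
    · exact ⟨s, fun h => absurd h hs⟩
  choose m hm using hm
  have hmF : ∀ s ∈ S, m s ∈ Fs := fun s hs => (Finset.mem_filter.1 (hm s hs).1).1
  have hm2 : ∀ s ∈ S, G.dist (m s) s ≤ 2 := fun s hs => (Finset.mem_filter.1 (hm s hs).1).2
  have hσm : ∀ s ∈ S, σ (m s) = s := fun s hs => hσ2 _ s hs (hm2 s hs)
  have hgather : ∀ s, ∃ y' : V → ℝ, s ∈ S → (∀ a, 0 ≤ y' a ∧ y' a ≤ 1) ∧ y' (m s) = 1 ∧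
      ∑ a ∈ Fs with σ a = s, y' a = ∑ a ∈ Fs with σ a = s, y a ∧
      (∀ U ⊆ Fs.filter (σ · = s), Disjoint U (B s) →
        ∑ a ∈ U, (L a : ℝ) * y a = ∑ a ∈ U, (L a : ℝ) * y' a) ∧
      ∀ U ⊆ Fs.filter (σ · = s),
        ∑ a ∈ U, (L a : ℝ) * y a ≤ ∑ a ∈ insert (m s) U, (L a : ℝ) * y' a := by
    intro s
    by_cases hs : s ∈ S
    · obtain ⟨y', hy'⟩ := exists_gather (Fs.filter (σ · = s)) (B s) (m s) (fun a => (L a : ℝ)) y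
        (fun b hb => Finset.mem_filter.2 ⟨(Finset.mem_filter.1 hb).1,
          hσ2 b s hs (Finset.mem_filter.1 hb).2⟩)
        (hm s hs).1 (fun a => Nat.cast_nonneg _) (fun b hb => Nat.cast_le.2 ((hm s hs).2 b hb)) hy
        (by
          refine (hyS s hs).trans_eq (Finset.sum_congr ?_ fun _ _ => rfl)
          ext u
          simp only [B, Finset.mem_filter, hdist]
          norm_cast)
      exact ⟨y', fun _ => by convert hy'⟩
    · exact ⟨y, fun h => absurd h hs⟩
  choose y' hy' using hgather
  let Y : V → ℝ := fun u => y' (σ u) u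
  have hY : ∀ u, 0 ≤ Y u ∧ Y u ≤ 1 := fun u => (hy' _ (hσS u)).1 u
  have hYm : ∀ s ∈ S, Y (m s) = 1 := fun s hs => by
    simp only [Y, hσm s hs]; exact (hy' s hs).2.1
  have hYsum : ∑ u ∈ Fs, Y u = k := by
    rw [← hysum, ← Finset.sum_fiberwise_of_maps_to (fun u _ => hσS u) Y,
      ← Finset.sum_fiberwise_of_maps_to (fun u _ => hσS u) y]
    refine Finset.sum_congr rfl fun s hs => ?_
    rw [← (hy' s hs).2.2.1]
    exact Finset.sum_congr rfl fun u hu => by simp only [Y, (Finset.mem_filter.1 hu).2]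
  let par : V → V := fun u =>
    if u = m (σ u) then if σ u = r then u else m (π (σ u)) else m (σ u)
  have hpar : ∀ u, ∃ s ∈ S, par u = m s ∧
      ((u ≠ m (σ u) ∧ s = σ u) ∨
        (u = m (σ u) ∧ ((u = m r ∧ s = r ∧ σ u = r) ∨ (σ u ≠ r ∧ s = π (σ u))))) := by
    intro u
    by_cases h1 : u = m (σ u)
    · by_cases h2 : σ u = r
      · exact ⟨r, hr, by simp only [par, if_pos h1, if_pos h2]; exact h2 ▸ h1,
          Or.inr ⟨h1, Or.inl ⟨h2 ▸ h1, rfl, h2⟩⟩⟩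
      · exact ⟨π (σ u), (hπ _ (hσS u) h2).1, by simp only [par, if_pos h1, if_neg h2],
          Or.inr ⟨h1, Or.inr ⟨h2, rfl⟩⟩⟩
    · exact ⟨σ u, hσS u, by simp only [par, if_neg h1], Or.inl ⟨h1, rfl⟩⟩
  have hparr : par (m r) = m r := by simp [par, hσm r hr]
  obtain ⟨F, hF, hFc, hcovers⟩ := exists_covers_of_tree par (m r)
    (fun u => 2 * d (σ u) + if u = m (σ u) then 0 else 1) hparr Fs.card Fs (fun u => (L u : ℝ)) Y k
    rfl (by
      intro u hu hur
      obtain ⟨s, hs, hps, h⟩ := hpar u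
      refine ⟨hps ▸ hmF s hs, ?_⟩
      rw [hps]
      simp only [hσm s hs, if_true]
      rcases h with ⟨h1, rfl⟩ | ⟨h1, ⟨h2, -⟩ | ⟨h2, rfl⟩⟩
      · rw [if_neg h1]; omega
      · exact absurd h2 hur
      · have := (hπ _ (hσS u) h2).2.2
        rw [if_pos h1]; omega)
    (fun u => Nat.cast_nonneg _) (fun u _ => hY u)
    (by
      intro u _ _
      obtain ⟨s, hs, hps, -⟩ := hpar u
      rw [hps, hYm s hs])
    hYsum
  have hstep : ∀ a, (a = m (σ a) → G.dist (σ a) (σ (par a)) ≤ 10) ∧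
      (a ≠ m (σ a) → σ (par a) = σ a) := by
    intro a
    obtain ⟨s, hs, hps, h⟩ := hpar a
    rw [hps, hσm s hs]
    rcases h with ⟨h1, rfl⟩ | ⟨h1, ⟨-, h2, h3⟩ | ⟨h2, rfl⟩⟩
    · exact ⟨fun h => absurd h h1, fun _ => rfl⟩
    · exact ⟨fun _ => by rw [h2, h3]; simp, fun h => absurd h1 h⟩
    · exact ⟨fun _ => (hπ _ (hσS a) h2).2.1, fun h => absurd h1 h⟩
  have hparm : ∀ a, par a = m (σ (par a)) := by
    intro a
    obtain ⟨s, hs, hps, -⟩ := hpar a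
    rw [hps, hσm s hs]
  have hone : ∀ a u, G.dist u (σ a) ≤ 5 → (a = m (σ a) → G.dist u (σ a) ≤ 2) →
      G.dist u (σ (par a)) ≤ 12 := by
    intro a u h5 h2
    by_cases ha : a = m (σ a)
    · have h3 := (hstep a).1 ha
      have h4 := h2 ha
      have h5 := htri u (σ a) (σ (par a))
      omega
    · rw [(hstep a).2 ha]; omega
  have htwo : ∀ a u, G.dist u (σ a) ≤ 5 → (a = m (σ a) → G.dist u (σ a) ≤ 2) →
      G.dist u (σ (par (par a))) ≤ 22 := by
    intro a u h5 h2
    have h1 := hone a u h5 h2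
    have h3 := (hstep (par a)).1 (hparm a)
    have h4 := htri u (σ (par a)) (σ (par (par a)))
    omega
  have hself : ∀ a, a = m (σ a) → G.dist a (σ a) ≤ 2 := by
    intro a ha
    have := hm2 _ (hσS a)
    rwa [← ha] at this
  have hnear : ∀ a b u, σ u = σ a → (a = m (σ a) → G.dist u (σ u) ≤ 2) → Near par a b →
      G.dist u b ≤ 24 := by
    intro a b u hua hu2 hab
    have hu5 := hσ5 u
    rw [hua] at hu5 hu2
    have hcenter : ∀ c e, par c = e → e = m (σ e) := by
      rintro c e rfl
      exact hparm c
    have hu1 := hone a u hu5 hu2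
    have hu22 := htwo a u hu5 hu2
    have hb5 := hσ5 b
    have hb2 := hself b
    have hb1 := hone b b hb5 hb2
    have hb22 := htwo b b hb5 hb2
    rcases hab with h | h | h | h | h
    · have := htri' u (σ (par a)) b
      rw [h] at this
      rw [h] at hu1
      omega
    · have := htri' u (σ b) b
      rw [h] at hu1
      omega
    · have := htri' u (σ a) b
      rw [h] at hb1
      omega
    · have := htri' u (σ b) b
      rw [h] at hu22
      have := hb2 (hcenter _ _ h)
      omega
    · have := htri' u (σ a) b
      rw [h] at hb22
      have := hu2 (hcenter _ _ h)
      omega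
  refine hLPSat.exists_isSolution hconn hF hFc fun T hT => ?_
  let U : Finset V := {a ∈ Fs | a ∈ T ∨ ∃ u ∈ T, a = m (σ u) ∧ G.dist u (σ u) ≤ 2}
  have hTU : ∑ u ∈ T, (L u : ℝ) * y u ≤ ∑ u ∈ U, (L u : ℝ) * Y u := by
    rw [← Finset.sum_fiberwise_of_maps_to (fun u _ => hσS u) fun u => (L u : ℝ) * y u,
      ← Finset.sum_fiberwise_of_maps_to (fun u _ => hσS u) fun u => (L u : ℝ) * Y u]
    refine Finset.sum_le_sum fun s hs => ?_
    have hTs : T.filter (σ · = s) ⊆ Fs.filter (σ · = s) := Finset.filter_subset_filter _ hT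
    have hTU : T.filter (σ · = s) ⊆ U.filter (σ · = s) :=
      Finset.filter_subset_filter _ fun a ha => Finset.mem_filter.2 ⟨hT ha, Or.inl ha⟩
    have hYs : ∑ u ∈ U with σ u = s, (L u : ℝ) * Y u = ∑ u ∈ U with σ u = s, (L u : ℝ) * y' s u :=
      Finset.sum_congr rfl fun u hu => by simp only [Y, (Finset.mem_filter.1 hu).2]
    have hmono : ∀ W ⊆ U.filter (σ · = s), ∑ u ∈ W, (L u : ℝ) * y' s u
        ≤ ∑ u ∈ U with σ u = s, (L u : ℝ) * y' s u := fun W hW =>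
      Finset.sum_le_sum_of_subset_of_nonneg hW fun u _ _ =>
        mul_nonneg (Nat.cast_nonneg _) ((hy' s hs).1 u).1
    rw [hYs]
    by_cases hdisj : Disjoint (T.filter (σ · = s)) (B s)
    · rw [(hy' s hs).2.2.2.1 _ hTs hdisj]
      exact hmono _ hTU
    · refine ((hy' s hs).2.2.2.2 _ hTs).trans (hmono _ (Finset.insert_subset ?_ hTU))
      obtain ⟨u, hu, huB⟩ := Finset.not_disjoint_iff.1 hdisj
      obtain ⟨huT, rfl⟩ := Finset.mem_filter.1 hu
      exact Finset.mem_filter.2 ⟨Finset.mem_filter.2 ⟨hmF _ hs,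
        Or.inr ⟨u, huT, rfl, (Finset.mem_filter.1 huB).2⟩⟩, hσm _ hs⟩
  refine hTU.trans ((hcovers U (Finset.filter_subset _ _)).trans
    (Finset.sum_le_sum_of_subset_of_nonneg ?_ fun b _ _ => Nat.cast_nonneg _))
  intro b hb
  obtain ⟨hbF, a, ha, hab⟩ := Finset.mem_filter.1 hb
  refine Finset.mem_filter.2 ⟨hbF, ?_⟩
  rcases (Finset.mem_filter.1 ha).2 with haT | ⟨u, hu, rfl, hu2⟩
  · exact ⟨a, haT, hnear a b a rfl (hself a) hab⟩
  · exact ⟨u, hu, hnear _ b u (hσm _ (hσS u)).symm (fun _ => hu2) hab⟩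
end

section
/- Let (G, L, k, p) be a graphic instance of capacitated k-supplier with outliers, let S ⊆ ℱ, let (x, y) be a feasible solution of LP_{k,p}(G, L, S), and let F ⊆ ℱ be an integral distance-r transfer of (G, L, y) (taking W = ℱ). Then there exists a distance-(r+1) solution (C, F, φ) whose set of open facilities is exactly F. -/
open Finset

open scoped Classical

/-- `y'` is a distance-`r` transfer of `(H, L, y)` on the vertex subset `W`: the total mass
is preserved and, for every `U ⊆ W`, the `L`-weighted mass of `y'` within distance `r`
of `U` is at least the `L`-weighted mass of `y` on `U`. -/
def IsTransfer {V : Type*} [Fintype V] (H : SimpleGraph V) (W : Finset V)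
    (L : V → ℕ) (r : ℕ) (y y' : V → ℝ) : Prop :=
  (∑ v ∈ W, y' v = ∑ v ∈ W, y v) ∧
    ∀ U ⊆ W, ∑ u ∈ U, (L u : ℝ) * y u ≤
      ∑ v ∈ W.filter (fun v => ∃ u ∈ U, H.edist v u ≤ (r : ℕ∞)), (L v : ℝ) * y' v

/-- `F ⊆ W` is an integral distance-`r` transfer of `(H, L, y)`: the characteristic
vector of `F` is a distance-`r` transfer of `(H, L, y)`. -/
def IsIntegralTransfer {V : Type*} [Fintype V] [DecidableEq V] (H : SimpleGraph V)
    (W : Finset V) (L : V → ℕ) (r : ℕ) (y : V → ℝ) (F : Finset V) : Prop :=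
  F ⊆ W ∧ IsTransfer H W L r y (fun v => if v ∈ F then 1 else 0)

/-- Deficiency version of Hall's theorem with capacities: if the neighbourhood of each `T ⊆ A`
has enough capacity, then `p` elements of `A` can be assigned to neighbours within the
capacities `L`. -/
theorem exists_capacitated_assignment {α β : Type*} [DecidableEq α] [DecidableEq β]
    [Nonempty (α → β)] (A : Finset α) (t : α → Finset β) (L : β → ℕ) (p : ℕ)
    (h : ∀ T ⊆ A, p + T.card ≤ A.card + ∑ u ∈ T.biUnion t, L u) :
    ∃ C ⊆ A, C.card = p ∧ ∃ φ : α → β, (∀ v ∈ C, φ v ∈ t v) ∧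
      ∀ u, (C.filter (fun v => φ v = u)).card ≤ L u := by
  obtain ⟨φ₀⟩ := ‹Nonempty (α → β)›
  have hp : p ≤ A.card := by simpa using h ∅ (empty_subset _)
  let slots : Finset β → Finset ((_ : β) × ℕ) := fun s => s.sigma fun u => range (L u)
  -- Each element of `A` may also use one of `A.card - p` dummy slots.
  obtain ⟨f, hf, hft⟩ := (Finset.all_card_le_biUnion_card_iff_exists_injective
    (fun v : A => (slots (t v)).disjSum (range (A.card - p)))).1 (by
      intro T
      rcases T.eq_empty_or_nonempty with rfl | ⟨v₀, hv₀⟩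
      · simp
      have hT := h (T.map (Function.Embedding.subtype _)) (by
        intro v hv
        obtain ⟨w, -, rfl⟩ := Finset.mem_map.1 hv
        exact w.2)
      rw [card_map] at hT
      have hsub : (slots ((T.map (Function.Embedding.subtype _)).biUnion t)).disjSum
          (range (A.card - p)) ⊆
          T.biUnion fun v : A => (slots (t v)).disjSum (range (A.card - p)) := by
        rintro (⟨u, i⟩ | j) hz
        · rw [inl_mem_disjSum, mem_sigma, mem_biUnion] at hz
          obtain ⟨⟨v, hv, hu⟩, hi⟩ := hz
          obtain ⟨w, hw, rfl⟩ := Finset.mem_map.1 hv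
          exact mem_biUnion.2 ⟨w, hw, inl_mem_disjSum.2 (mem_sigma.2 ⟨hu, hi⟩)⟩
        · exact mem_biUnion.2 ⟨v₀, hv₀, inr_mem_disjSum.2 (inr_mem_disjSum.1 hz)⟩
      have hcard := card_le_card hsub
      rw [card_disjSum, card_sigma, card_range] at hcard
      simp only [card_range] at hcard
      omega)
  let D : Finset A := univ.filter fun v => (f v).isLeft
  have hD : p ≤ D.card := by
    have hdummy : (univ.filter fun v : A => ¬ (f v).isLeft).card ≤ A.card - p := by
      calc _ ≤ ((range (A.card - p)).map
          (Function.Embedding.inr (α := (_ : β) × ℕ))).card := by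
            refine card_le_card_of_injOn f (fun v hv => ?_) hf.injOn
            have hv' := (mem_filter.1 hv).2
            have hm := hft v
            cases hfv : f v with
            | inl z => simp [hfv] at hv'
            | inr j => simpa [hfv] using hm
        _ = A.card - p := by simp
    have := card_filter_add_card_filter_not (s := (univ : Finset A)) (fun v => (f v).isLeft)
    simp only [card_univ, Fintype.card_coe] at this
    change p ≤ (univ.filter fun v : A => (f v).isLeft).card
    omega
  obtain ⟨D', hD', hcard⟩ := exists_subset_card_eq hD
  let φ : α → β := fun v => if hv : v ∈ A then
    (f ⟨v, hv⟩).elim (fun z => z.1) (fun _ => φ₀ v) else φ₀ v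
  refine ⟨D'.map (Function.Embedding.subtype _), ?_, by simpa using hcard, φ, ?_, ?_⟩
  · intro v hv
    obtain ⟨w, -, rfl⟩ := Finset.mem_map.1 hv
    exact w.2
  · intro v hv
    obtain ⟨⟨w, hwA⟩, hw, rfl⟩ := Finset.mem_map.1 hv
    have hl := (mem_filter.1 (hD' hw)).2
    have hm := hft ⟨w, hwA⟩
    cases hfv : f ⟨w, hwA⟩ with
    | inr j => simp [hfv] at hl
    | inl z =>
      rw [hfv, inl_mem_disjSum, mem_sigma] at hm
      simpa [φ, hwA, hfv] using hm.1
  · intro u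
    rw [filter_map, card_map]
    calc _ ≤ ((range (L u)).map
          ⟨fun i => (Sum.inl ⟨u, i⟩ : ((_ : β) × ℕ) ⊕ ℕ),
            fun i j hij => by simpa using hij⟩).card := by
          refine card_le_card_of_injOn f (fun v hv => ?_) hf.injOn
          obtain ⟨hv, hvu⟩ := mem_filter.1 hv
          obtain ⟨w, hwA⟩ := v
          have hl := (mem_filter.1 (hD' hv)).2
          have hm := hft ⟨w, hwA⟩
          cases hfv : f ⟨w, hwA⟩ with
          | inr j => simp [hfv] at hl
          | inl z =>
            obtain ⟨b, i⟩ := z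
            rw [hfv, inl_mem_disjSum, mem_sigma] at hm
            have hb : b = u := by simpa [φ, hwA, hfv] using hvu
            subst hb
            exact Finset.mem_map.2 ⟨i, hm.2, rfl⟩
      _ = L u := by simp

/-- Given a feasible LP solution `(x, y)` and an integral distance-`r`
transfer `F ⊆ ℱ` of `(G, L, y)`, there is a distance-`(r+1)` solution opening exactly
the facilities of `F`. -/
theorem transfer_to_solution {V : Type*} [Fintype V] [DecidableEq V]
    (G : SimpleGraph V) (Cs Fs : Finset V) (L : V → ℕ) (k p r : ℕ)
    (hinst : IsGraphicInstance G Cs Fs)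
    (S : Finset V) (hSF : S ⊆ Fs)
    (x : V → V → ℝ) (y : V → ℝ) (hxy : LPSat G Cs Fs L k p S x y)
    (F : Finset V) (hF : IsIntegralTransfer G Fs L r y F) :
    ∃ C φ, IsSolution G Cs Fs L k p (r + 1) C F φ := by
  obtain ⟨hFW, hmass, htrans⟩ := hF
  obtain ⟨-, hx, hyk, hxp, -, hcap, hdem, -, hadj⟩ := hxy
  have hFk : F.card = k := by
    have hsum : ∑ v ∈ Fs, (if v ∈ F then (1 : ℝ) else 0) = F.card := by
      rw [sum_ite_mem, inter_eq_right.2 hFW]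
      simp
    exact_mod_cast hsum.symm.trans (hmass.trans hyk)
  have : Nonempty (V → V) := ⟨id⟩
  let t : V → Finset V := fun v => F.filter fun u => G.edist v u ≤ ((r + 1 : ℕ) : ℕ∞)
  obtain ⟨C, hC, hCp, φ, hφ, hload⟩ := exists_capacitated_assignment Cs t L p (by
    intro T hT
    let U := Fs.filter fun u => ∃ v ∈ T, G.Adj v u
    have hout : ∑ v ∈ Cs \ T, ∑ u ∈ Fs, x u v ≤ (Cs \ T).card := by
      simpa using sum_le_card_nsmul (Cs \ T) (fun v => ∑ u ∈ Fs, x u v) 1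
        fun v hv => hdem v (mem_sdiff.1 hv).1
    have hin : ∑ v ∈ T, ∑ u ∈ Fs, x u v ≤ ∑ u ∈ T.biUnion t, (L u : ℝ) := by
      calc ∑ v ∈ T, ∑ u ∈ Fs, x u v = ∑ v ∈ T, ∑ u ∈ U, x u v := by
            refine sum_congr rfl fun v hv => (sum_subset (filter_subset _ _) ?_).symm
            intro u hu huU
            exact hadj u hu v (hT hv) fun huv => huU (mem_filter.2 ⟨hu, v, hv, huv⟩)
        _ = ∑ u ∈ U, ∑ v ∈ T, x u v := sum_comm
        _ ≤ ∑ u ∈ U, ∑ v ∈ Cs, x u v := sum_le_sum fun u _ =>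
            sum_le_sum_of_subset_of_nonneg hT fun v _ _ => (hx u v).1
        _ ≤ ∑ u ∈ U, (L u : ℝ) * y u := sum_le_sum fun u hu => hcap u (mem_filter.1 hu).1
        _ ≤ _ := htrans U (filter_subset _ _)
        _ ≤ ∑ u ∈ T.biUnion t, (L u : ℝ) := by
            simp only [mul_ite, mul_one, mul_zero]
            rw [← sum_filter]
            refine sum_le_sum_of_subset_of_nonneg ?_ fun _ _ _ => Nat.cast_nonneg _
            intro w hw
            obtain ⟨hw, hwF⟩ := mem_filter.1 hw
            obtain ⟨-, u, hu, hwu⟩ := mem_filter.1 hw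
            obtain ⟨-, v, hv, hvu⟩ := mem_filter.1 hu
            refine mem_biUnion.2 ⟨v, hv, mem_filter.2 ⟨hwF, ?_⟩⟩
            calc G.edist v w ≤ G.edist v u + G.edist u w := G.edist_triangle
              _ ≤ 1 + r := add_le_add (SimpleGraph.edist_eq_one_iff_adj.2 hvu).le
                  (SimpleGraph.edist_comm.trans_le hwu)
              _ = ((r + 1 : ℕ) : ℕ∞) := by push_cast; exact add_comm _ _
    have hreal : (p : ℝ) ≤ (Cs \ T).card + ∑ u ∈ T.biUnion t, (L u : ℝ) := by
      rw [← hxp, sum_comm, ← sum_sdiff hT]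
      exact add_le_add hout hin
    have hnat : p ≤ (Cs \ T).card + ∑ u ∈ T.biUnion t, L u := by exact_mod_cast hreal
    have := card_sdiff_add_card_eq_card hT
    omega)
  exact ⟨C, φ, hC, hFW, hCp, hFk, fun v hv => (mem_filter.1 (hφ v hv)).1,
    fun u _ => by convert hload u, fun v hv => (mem_filter.1 (hφ v hv)).2⟩
end

section
/- Let H = (V, E) be a finite graph, W ⊆ V, L : W → ℕ a capacity function, and y, y', y'' ∈ ℝ_{≥0}^W. If y' is a distance-r transfer of (H, L, y) and y'' is a distance-r' transfer of (H, L, y'), then y'' is a distance-(r+r') transfer of (H, L, y). -/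
open Finset

open scoped Classical

/-- Transfers compose: a distance-`r` transfer followed by a
distance-`r'` transfer is a distance-`(r + r')` transfer. -/
theorem transfer_comp {V : Type*} [Fintype V]
    (H : SimpleGraph V) (W : Finset V) (L : V → ℕ) (r r' : ℕ)
    (y y' y'' : V → ℝ)
    (hy : ∀ v ∈ W, 0 ≤ y v) (hy' : ∀ v ∈ W, 0 ≤ y' v) (hy'' : ∀ v ∈ W, 0 ≤ y'' v)
    (h1 : IsTransfer H W L r y y') (h2 : IsTransfer H W L r' y' y'') :
    IsTransfer H W L (r + r') y y'' := by
  refine ⟨h2.1.trans h1.1, fun U hU => ?_⟩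
  refine (h1.2 U hU).trans ((h2.2 _ (filter_subset _ _)).trans ?_)
  refine sum_le_sum_of_subset_of_nonneg ?_ fun v hv _ =>
    mul_nonneg (Nat.cast_nonneg _) (hy'' v (mem_filter.1 hv).1)
  intro v hv
  obtain ⟨hvW, w, hw, hvw⟩ := mem_filter.1 hv
  obtain ⟨-, u, hu, hwu⟩ := mem_filter.1 hw
  refine mem_filter.2 ⟨hvW, u, hu, ?_⟩
  calc H.edist v u ≤ H.edist v w + H.edist w u := H.edist_triangle
    _ ≤ r' + r := add_le_add hvw hwu
    _ = ((r + r' : ℕ) : ℕ∞) := by rw [Nat.cast_add, add_comm]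
end

section
/- Let T = (V, E) be a finite tree with a capacity function L : V → ℕ and let y ∈ [0,1]^V be a vector such that y_v = 1 for every non-leaf vertex v of T and Σ_{v∈V} y_v is an integer. Then there exists a set F ⊆ V that is an integral distance-2 transfer of (T, L, y). -/
open Finset

open scoped Classical

/-- `F ⊆ W` is an integral transfer of `(W, ℓ, y)` along the relation `R`. -/
def IsRelTransfer {V : Type*} (R : V → V → Prop) (W : Finset V) (ℓ y : V → ℝ)
    (F : Finset V) : Prop :=
  F ⊆ W ∧ (#F : ℝ) = ∑ v ∈ W, y v ∧
    ∀ U ⊆ W, ∑ u ∈ U, ℓ u * y u ≤ ∑ v ∈ F with ∃ u ∈ U, R v u, ℓ v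

theorem exists_subset_card_eq_forall_le {V : Type*} [DecidableEq V] (C : Finset V) (ℓ : V → ℝ)
    (k : ℕ) (hk : k ≤ #C) : ∃ G ⊆ C, #G = k ∧ ∀ a ∈ G, ∀ b ∈ C \ G, ℓ b ≤ ℓ a := by
  induction k with
  | zero => exact ⟨∅, by simp, by simp, by simp⟩
  | succ k ih =>
    obtain ⟨G, hGC, hGk, hG⟩ := ih (by omega)
    have hne : (C \ G).Nonempty := by
      rw [← Finset.card_pos, Finset.card_sdiff_of_subset hGC]; omega
    obtain ⟨m, hm, hmax⟩ := Finset.exists_max_image (C \ G) ℓ hne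
    have hm' := Finset.mem_sdiff.1 hm
    refine ⟨insert m G, Finset.insert_subset hm'.1 hGC, ?_, ?_⟩
    · rw [Finset.card_insert_of_notMem hm'.2, hGk]
    · intro a ha b hb
      simp only [Finset.mem_sdiff, Finset.mem_insert, not_or] at hb
      have hb' : b ∈ C \ G := Finset.mem_sdiff.2 ⟨hb.1, hb.2.2⟩
      rcases Finset.mem_insert.1 ha with rfl | ha
      · exact hmax b hb'
      · exact hG a ha b hb'

/-- Greedy rounding of a fractional knapsack solution of total mass `k + s`. -/
theorem exists_greedy_rounding {V : Type*} [DecidableEq V] (C : Finset V) (ℓ y : V → ℝ)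
    (hy : ∀ v, 0 ≤ y v ∧ y v ≤ 1) (k : ℕ) (s : ℝ) (hs : 0 < s)
    (hsum : ∑ c ∈ C, y c = k + s) :
    ∃ G ⊆ C, ∃ m ∈ C, m ∉ G ∧ #G = k ∧ ∑ c ∈ C, ℓ c * y c ≤ ∑ c ∈ G, ℓ c + s * ℓ m := by
  have hk : k < #C := by
    have h : ∑ c ∈ C, y c ≤ ∑ c ∈ C, (1 : ℝ) := Finset.sum_le_sum fun c _ => (hy c).2
    rw [Finset.sum_const, nsmul_eq_mul, mul_one, hsum] at h
    exact_mod_cast (by linarith : (k : ℝ) < #C)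
  obtain ⟨G, hGC, hGk, hG⟩ := exists_subset_card_eq_forall_le C ℓ k hk.le
  have hne : (C \ G).Nonempty := by
    rw [← Finset.card_pos, Finset.card_sdiff_of_subset hGC]; omega
  obtain ⟨m, hm, hmax⟩ := Finset.exists_max_image (C \ G) ℓ hne
  have hm' := Finset.mem_sdiff.1 hm
  refine ⟨G, hGC, m, hm'.1, hm'.2, hGk, ?_⟩
  have h₁ : ∑ c ∈ C \ G, (ℓ c - ℓ m) * y c ≤ 0 := Finset.sum_nonpos fun c hc =>
    mul_nonpos_of_nonpos_of_nonneg (sub_nonpos.2 (hmax c hc)) (hy c).1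
  have h₂ : ∑ c ∈ G, (ℓ c - ℓ m) * y c ≤ ∑ c ∈ G, (ℓ c - ℓ m) := Finset.sum_le_sum fun c hc =>
    mul_le_of_le_one_right (sub_nonneg.2 (hG c hc m hm)) (hy c).2
  have h₃ := Finset.sum_sdiff hGC (f := fun c => (ℓ c - ℓ m) * y c)
  simp only [sub_mul, Finset.sum_sub_distrib, ← Finset.mul_sum, hsum, Finset.sum_const, hGk,
    nsmul_eq_mul] at h₁ h₂ h₃
  linarith

/-- If all pairs of vertices are related, greedy rounding yields a transfer. -/
theorem exists_isRelTransfer_of_forall_rel {V : Type*} [DecidableEq V] (R : V → V → Prop)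
    (W : Finset V) (ℓ y : V → ℝ) (hℓ : ∀ v, 0 ≤ ℓ v) (hy : ∀ v, 0 ≤ y v ∧ y v ≤ 1)
    (hR : ∀ a ∈ W, ∀ b ∈ W, R a b) (hint : ∃ n : ℤ, ∑ v ∈ W, y v = n) :
    ∃ F, IsRelTransfer R W ℓ y F := by
  suffices h : ∃ F ⊆ W, (#F : ℝ) = ∑ v ∈ W, y v ∧ ∑ v ∈ W, ℓ v * y v ≤ ∑ v ∈ F, ℓ v by
    obtain ⟨F, hFW, hcard, hle⟩ := h
    refine ⟨F, hFW, hcard, fun U hU => ?_⟩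
    rcases U.eq_empty_or_nonempty with rfl | ⟨u, hu⟩
    · simp
    · rw [Finset.filter_true_of_mem fun v hv => ⟨u, hu, hR v (hFW hv) u (hU hu)⟩]
      exact (Finset.sum_le_sum_of_subset_of_nonneg hU
        fun v _ _ => mul_nonneg (hℓ v) (hy v).1).trans hle
  obtain ⟨n, hn⟩ := hint
  have hn0 : 0 ≤ n := by
    exact_mod_cast hn ▸ Finset.sum_nonneg fun v (_ : v ∈ W) => (hy v).1
  lift n to ℕ using hn0
  rcases n with _ | k
  · refine ⟨∅, by simp, by simp [hn], ?_⟩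
    have h0 := (Finset.sum_eq_zero_iff_of_nonneg fun v _ => (hy v).1).1 (by simpa using hn)
    exact (Finset.sum_eq_zero fun v hv => by rw [h0 v hv, mul_zero]).le
  · obtain ⟨G, hGW, m, hm, hmG, hGk, hle⟩ :=
      exists_greedy_rounding W ℓ y hy k 1 one_pos (by rw [hn]; push_cast; ring)
    refine ⟨insert m G, Finset.insert_subset hm hGW, ?_, ?_⟩
    · rw [Finset.card_insert_of_notMem hmG, hGk, hn]; simp
    · rw [Finset.sum_insert hmG]; linarith

/-- Removing a cluster `C` attached to a vertex `v` of mass one. -/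
theorem exists_isRelTransfer_of_sdiff {V : Type*} [DecidableEq V] (R : V → V → Prop)
    (W C : Finset V) (v : V) (ℓ y : V → ℝ) (hℓ : ∀ x, 0 ≤ ℓ x) (hy : ∀ x, 0 ≤ y x ∧ y x ≤ 1)
    (hCW : C ⊆ W) (hvW : v ∈ W) (hvC : v ∉ C) (hyv : y v = 1)
    (hR : ∀ a ∈ insert v C, ∀ b ∈ insert v C, R a b)
    (hint : ∃ n : ℤ, ∑ x ∈ W, y x = n)
    (ih : ∀ ℓ' y' : V → ℝ, (∀ x, 0 ≤ ℓ' x) → (∀ x, 0 ≤ y' x ∧ y' x ≤ 1) →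
      (∀ x, x ≠ v → y' x = y x) → (∃ n : ℤ, ∑ x ∈ W \ C, y' x = n) →
      ∃ F, IsRelTransfer R (W \ C) ℓ' y' F) :
    ∃ F, IsRelTransfer R W ℓ y F := by
  obtain ⟨n, hn⟩ := hint
  have hsplit := Finset.sum_sdiff hCW (f := y)
  have hS0 : 0 ≤ ∑ c ∈ C, y c := Finset.sum_nonneg fun c _ => (hy c).1
  have hU_split : ∀ U : Finset V, ∑ u ∈ U, ℓ u * y u =
      ∑ u ∈ U \ C, ℓ u * y u + ∑ u ∈ U ∩ C, ℓ u * y u := fun U => by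
    rw [add_comm, Finset.sum_inter_add_sum_sdiff]
  have hU_le : ∀ U : Finset V, ∑ u ∈ U ∩ C, ℓ u * y u ≤ ∑ c ∈ C, ℓ c * y c := fun U =>
    Finset.sum_le_sum_of_subset_of_nonneg Finset.inter_subset_right
      fun x _ _ => mul_nonneg (hℓ x) (hy x).1
  have hfilter : ∀ (F U : Finset V) (f : V → ℝ), (∀ x, 0 ≤ f x) →
      ∑ x ∈ F with ∃ u ∈ U \ C, R x u, f x ≤ ∑ x ∈ F with ∃ u ∈ U, R x u, f x :=
    fun F U f hf => Finset.sum_le_sum_of_subset_of_nonneg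
      (Finset.monotone_filter_right F fun x _ ⟨u, hu, h⟩ => ⟨u, (Finset.mem_sdiff.1 hu).1, h⟩)
      fun x _ _ => hf x
  rcases hS0.eq_or_lt with hS | hS
  · obtain ⟨F, hFW, hFcard, hF⟩ := ih ℓ y hℓ hy (fun _ _ => rfl) ⟨n, by linarith⟩
    refine ⟨F, hFW.trans Finset.sdiff_subset, by linarith, fun U hU => ?_⟩
    have h0 := (Finset.sum_eq_zero_iff_of_nonneg fun c _ => (hy c).1).1 hS.symm
    have h1 : ∑ u ∈ U ∩ C, ℓ u * y u = 0 := Finset.sum_eq_zero fun u hu => by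
      rw [h0 u (Finset.mem_inter.1 hu).2, mul_zero]
    have := hF (U \ C) (Finset.sdiff_subset_sdiff hU subset_rfl)
    have := hfilter F U ℓ hℓ
    have := hU_split U
    linarith
  obtain ⟨k, hk⟩ : ∃ k : ℕ, ⌈∑ c ∈ C, y c⌉₊ = k + 1 :=
    Nat.exists_eq_succ_of_ne_zero (Nat.ceil_pos.2 hS).ne'
  obtain ⟨s, hs⟩ : ∃ s, ∑ c ∈ C, y c = k + s := ⟨_, (add_sub_cancel _ _).symm⟩
  have hs0 : 0 < s := by
    have := Nat.ceil_lt_add_one hS0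
    rw [hk] at this; push_cast at this; linarith
  have hs1 : s ≤ 1 := by
    have := Nat.le_ceil (∑ c ∈ C, y c)
    rw [hk] at this; push_cast at this; linarith
  obtain ⟨G, hGC, m, hmC, hmG, hGk, hle⟩ := exists_greedy_rounding C ℓ y hy k s hs0 hs
  have hvWC : v ∈ W \ C := Finset.mem_sdiff.2 ⟨hvW, hvC⟩
  have hy' : ∀ x, 0 ≤ Function.update y v s x ∧ Function.update y v s x ≤ 1 := fun x => by
    by_cases hx : x = v
    · subst hx; simp [hs0.le, hs1]
    · simp [hx, hy x]
  have hy'sum : ∑ x ∈ W \ C, Function.update y v s x = ∑ x ∈ W, y x - k - 1 := by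
    rw [Finset.sum_update_of_mem hvWC]
    have := Finset.sum_sdiff (Finset.singleton_subset_iff.2 hvWC) (f := y)
    rw [Finset.sum_singleton] at this
    linarith
  have hint' : ∃ n : ℤ, ∑ x ∈ W \ C, Function.update y v s x = n :=
    ⟨n - k - 1, by rw [hy'sum, hn]; push_cast; ring⟩
  have hupd : ∀ (t : ℝ) (B : Finset V), ∑ u ∈ B, ℓ u * y u =
      ∑ u ∈ B, Function.update ℓ v t u * Function.update y v s u +
        if v ∈ B then ℓ v - s * t else 0 := fun t B => by
    split_ifs with hvB
    · rw [← Finset.add_sum_erase _ _ hvB, ← Finset.add_sum_erase B (fun u => _ * _) hvB]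
      have : ∑ u ∈ B.erase v, Function.update ℓ v t u * Function.update y v s u =
          ∑ u ∈ B.erase v, ℓ u * y u := Finset.sum_congr rfl fun u hu => by
        simp [Finset.ne_of_mem_erase hu]
      rw [this, hyv]; simp; ring
    · rw [add_zero]
      refine Finset.sum_congr rfl fun u hu => ?_
      have : u ≠ v := fun h => hvB (h ▸ hu)
      simp [this]
  have hdisj : ∀ {F' G' : Finset V}, F' ⊆ W \ C → G' ⊆ C → Disjoint F' G' := fun hF' hG' =>
    Finset.disjoint_of_subset_left hF' (Finset.disjoint_of_subset_right hG' Finset.sdiff_disjoint)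
  have hmGC : insert m G ⊆ C := Finset.insert_subset hmC hGC
  have hsum_union : ∀ {F' G' : Finset V}, F' ⊆ W \ C → G' ⊆ C → ∀ U : Finset V,
      ∑ x ∈ F' ∪ G' with ∃ u ∈ U, R x u, ℓ x =
        ∑ x ∈ F' with ∃ u ∈ U, R x u, ℓ x + ∑ x ∈ G' with ∃ u ∈ U, R x u, ℓ x :=
    fun hF' hG' U => by
      rw [Finset.filter_union, Finset.sum_union
        (Finset.disjoint_filter_filter (hdisj hF' hG'))]
  have hsm : s * ℓ m ≤ ℓ m := mul_le_of_le_one_left (hℓ m) hs1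
  have hnear : ∀ {U : Finset V}, (v ∈ U \ C ∨ (U ∩ C).Nonempty) →
      ∀ x ∈ insert v C, ∃ u ∈ U, R x u := fun h x hx => by
    rcases h with h | ⟨u, hu⟩
    · exact ⟨v, (Finset.mem_sdiff.1 h).1, hR x hx v (Finset.mem_insert_self _ _)⟩
    · exact ⟨u, (Finset.mem_inter.1 hu).1, hR x hx u
        (Finset.mem_insert_of_mem (Finset.mem_inter.1 hu).2)⟩
  have hall : ∀ {U G' : Finset V}, (v ∈ U \ C ∨ (U ∩ C).Nonempty) → G' ⊆ C →
      ∑ x ∈ G' with ∃ u ∈ U, R x u, ℓ x = ∑ x ∈ G', ℓ x := fun h hG' => by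
    rw [Finset.filter_true_of_mem fun x hx => hnear h x (Finset.mem_insert_of_mem (hG' hx))]
  have hnn : ∀ G' U : Finset V, 0 ≤ ∑ x ∈ G' with ∃ u ∈ U, R x u, ℓ x :=
    fun G' U => Finset.sum_nonneg fun x _ => hℓ x
  have hunionW : ∀ {F' G' : Finset V}, F' ⊆ W \ C → G' ⊆ C → F' ∪ G' ⊆ W := fun hF' hG' =>
    Finset.union_subset (hF'.trans Finset.sdiff_subset) (hG'.trans hCW)
  rcases lt_or_ge (ℓ v) (ℓ m) with hlt | hge
  · obtain ⟨F, hFW, hFcard, hF⟩ := ih ℓ (Function.update y v s) hℓ hy'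
      (fun x hx => by simp [hx]) hint'
    refine ⟨F ∪ insert m G, hunionW hFW hmGC, ?_, fun U hU => ?_⟩
    · rw [Finset.card_union_of_disjoint (hdisj hFW hmGC), Finset.card_insert_of_notMem hmG, hGk]
      push_cast; linarith
    have h1 := hF (U \ C) (Finset.sdiff_subset_sdiff hU subset_rfl)
    have h2 := hfilter F U ℓ hℓ
    have h3 := hupd (ℓ v) (U \ C)
    rw [Function.update_eq_self] at h3
    have h5 := hU_le U
    rw [hU_split, hsum_union hFW hmGC, h3]
    by_cases hnr : v ∈ U \ C ∨ (U ∩ C).Nonempty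
    · rw [hall hnr hmGC, Finset.sum_insert hmG]
      have : (1 - s) * ℓ v ≤ (1 - s) * ℓ m :=
        mul_le_mul_of_nonneg_left hlt.le (by linarith)
      split_ifs <;> linarith
    · rw [not_or, Finset.not_nonempty_iff_eq_empty] at hnr
      rw [hnr.2, if_neg hnr.1, Finset.sum_empty]
      have := hnn (insert m G) U
      linarith
  · have hℓ' : ∀ x, 0 ≤ Function.update ℓ v (ℓ m) x := fun x => by
      by_cases hx : x = v
      · subst hx; simp [hℓ m]
      · simp [hx, hℓ x]
    obtain ⟨F, hFW, hFcard, hF⟩ := ih (Function.update ℓ v (ℓ m)) (Function.update y v s) hℓ' hy'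
      (fun x hx => by simp [hx]) hint'
    have hmono : ∀ U : Finset V,
        ∑ x ∈ F with ∃ u ∈ U, R x u, Function.update ℓ v (ℓ m) x +
          (if v ∈ F ∧ ∃ u ∈ U, R v u then ℓ v - ℓ m else 0) =
        ∑ x ∈ F with ∃ u ∈ U, R x u, ℓ x := fun U => by
      split_ifs with hv
      · rw [← Finset.mem_filter (p := fun x => ∃ u ∈ U, R x u)] at hv
        rw [Finset.sum_update_of_mem hv]
        have := Finset.sum_sdiff (Finset.singleton_subset_iff.2 hv) (f := ℓ)
        rw [Finset.sum_singleton] at this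
        linarith
      · rw [← Finset.mem_filter (p := fun x => ∃ u ∈ U, R x u)] at hv
        rw [Finset.sum_update_of_notMem hv, add_zero]
    by_cases hvF : v ∈ F
    · refine ⟨F ∪ insert m G, hunionW hFW hmGC, ?_, fun U hU => ?_⟩
      · rw [Finset.card_union_of_disjoint (hdisj hFW hmGC), Finset.card_insert_of_notMem hmG, hGk]
        push_cast; linarith
      have h1 := hF (U \ C) (Finset.sdiff_subset_sdiff hU subset_rfl)
      have h2 := hfilter F U _ hℓ'
      have h3 := hupd (ℓ m) (U \ C)
      have h4 := hmono U
      have h5 := hU_le U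
      rw [hU_split, hsum_union hFW hmGC, h3]
      by_cases hnr : v ∈ U \ C ∨ (U ∩ C).Nonempty
      · rw [hall hnr hmGC, Finset.sum_insert hmG]
        rw [if_pos ⟨hvF, hnear hnr v (Finset.mem_insert_self _ _)⟩] at h4
        split_ifs <;> linarith
      · rw [not_or, Finset.not_nonempty_iff_eq_empty] at hnr
        rw [hnr.2, if_neg hnr.1, Finset.sum_empty]
        have := hnn (insert m G) U
        split_ifs at h4 <;> linarith
    · have hvFW : insert v F ⊆ W \ C := Finset.insert_subset hvWC hFW
      refine ⟨insert v F ∪ G, hunionW hvFW hGC, ?_, fun U hU => ?_⟩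
      · rw [Finset.card_union_of_disjoint (hdisj hvFW hGC), Finset.card_insert_of_notMem hvF, hGk]
        push_cast; linarith
      have h1 := hF (U \ C) (Finset.sdiff_subset_sdiff hU subset_rfl)
      have h2 := hfilter F U _ hℓ'
      have h3 := hupd (ℓ m) (U \ C)
      have h4 := hmono U
      rw [if_neg fun h => hvF h.1, add_zero] at h4
      have h5 := hU_le U
      rw [hU_split, hsum_union hvFW hGC, h3]
      by_cases hnr : v ∈ U \ C ∨ (U ∩ C).Nonempty
      · rw [hall hnr hGC, Finset.filter_insert,
          if_pos (hnear hnr v (Finset.mem_insert_self _ _)), Finset.sum_insert (by simp [hvF])]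
        by_cases hvU : v ∈ U \ C
        · rw [if_pos hvU]; linarith
        · rw [if_neg hvU]; linarith
      · rw [not_or, Finset.not_nonempty_iff_eq_empty] at hnr
        rw [hnr.2, if_neg hnr.1, Finset.sum_empty]
        have := hnn G U
        have h6 : ∑ x ∈ F with ∃ u ∈ U, R x u, ℓ x ≤
            ∑ x ∈ insert v F with ∃ u ∈ U, R x u, ℓ x :=
          Finset.sum_le_sum_of_subset_of_nonneg
            (Finset.filter_subset_filter _ (Finset.subset_insert _ _)) fun x _ _ => hℓ x
        linarith

/-- Transfers along a rooted tree given by a parent map `p` and a depth function `d`. -/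
theorem exists_isRelTransfer_of_parent {V : Type*} [DecidableEq V] (R : V → V → Prop)
    (r : V) (p : V → V) (d : V → ℕ) (hd : ∀ x, x ≠ r → d (p x) + 1 = d x)
    (hrefl : ∀ x, R x x) (hup : ∀ x, x ≠ r → R x (p x)) (hdown : ∀ x, x ≠ r → R (p x) x)
    (hsib : ∀ x z, x ≠ r → z ≠ r → p x = p z → R x z) (W : Finset V) (ℓ y : V → ℝ)
    (hℓ : ∀ x, 0 ≤ ℓ x) (hy : ∀ x, 0 ≤ y x ∧ y x ≤ 1)
    (hW : ∀ x ∈ W, x ≠ r → p x ∈ W) (hone : ∀ x ∈ W, x ≠ r → p x ≠ r → y (p x) = 1)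
    (hint : ∃ n : ℤ, ∑ x ∈ W, y x = n) :
    ∃ F, IsRelTransfer R W ℓ y F := by
  have hstar : ∀ v, ∀ a, a = v ∨ (a ≠ r ∧ p a = v) → ∀ b, b = v ∨ (b ≠ r ∧ p b = v) → R a b := by
    rintro v a (rfl | ⟨ha, rfl⟩) b (rfl | ⟨hb, hb'⟩)
    · exact hrefl _
    · exact hb' ▸ hdown b hb
    · exact hup a ha
    · exact hsib a b ha hb hb'.symm
  induction hN : #W using Nat.strong_induction_on generalizing W ℓ y with
  | _ N ih =>
    rcases (W.filter fun x => x ≠ r ∧ p x ≠ r).eq_empty_or_nonempty with h | h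
    · rw [Finset.filter_eq_empty_iff] at h
      have h' : ∀ a ∈ W, a = r ∨ (a ≠ r ∧ p a = r) := fun a ha => by
        have := h ha; tauto
      exact exists_isRelTransfer_of_forall_rel R W ℓ y hℓ hy
        (fun a ha b hb => hstar r a (h' a ha) b (h' b hb)) hint
    · obtain ⟨x, hx, hmax⟩ := Finset.exists_max_image _ d h
      obtain ⟨hxW, hxr, hpxr⟩ := Finset.mem_filter.1 hx
      let C := W.filter fun c => c ≠ r ∧ p c = p x
      have hCW : C ⊆ W := Finset.filter_subset _ _
      have hmemC : ∀ a ∈ insert (p x) C, a = p x ∨ (a ≠ r ∧ p a = p x) := fun a ha => by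
        rcases Finset.mem_insert.1 ha with h | h
        · exact Or.inl h
        · exact Or.inr (Finset.mem_filter.1 h).2
      refine exists_isRelTransfer_of_sdiff R W C (p x) ℓ y hℓ hy hCW (hW x hxW hxr) ?_
        (hone x hxW hxr hpxr) (fun a ha b hb => hstar (p x) a (hmemC a ha) b (hmemC b hb)) hint ?_
      · intro hmem
        have h1 := (Finset.mem_filter.1 hmem).2.2
        have h2 := hd (p x) hpxr
        rw [h1] at h2
        omega
      · intro ℓ' y' hℓ' hy' hyy' hint'
        refine ih _ ?_ (W \ C) ℓ' y' hℓ' hy' ?_ ?_ hint' rfl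
        · rw [← hN]
          exact Finset.card_lt_card (Finset.sdiff_ssubset hCW
            ⟨x, Finset.mem_filter.2 ⟨hxW, hxr, rfl⟩⟩)
        · intro z hz hzr
          have hzW := (Finset.mem_sdiff.1 hz).1
          refine Finset.mem_sdiff.2 ⟨hW z hzW hzr, fun hmem => ?_⟩
          obtain ⟨-, hpz, hppz⟩ := Finset.mem_filter.1 hmem
          have h1 := hmax z (Finset.mem_filter.2 ⟨hzW, hzr, hpz⟩)
          have h2 := hd z hzr
          have h3 := hd (p z) hpz
          have h4 := hd x hxr
          rw [hppz] at h3
          omega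
        · intro z hz hzr hpz
          obtain ⟨hzW, hzC⟩ := Finset.mem_sdiff.1 hz
          rw [hyy' _ fun h => hzC (Finset.mem_filter.2 ⟨hzW, hzr, h⟩)]
          exact hone z hzW hzr hpz

/-- (An, Bhaskara, Svensson.) For a finite tree `T` with capacities `L`
and `y ∈ [0,1]^V` with `y_v = 1` on every non-leaf (degree at least 2) vertex and integral
total mass, there is an integral distance-2 transfer of `(T, L, y)`. -/
theorem tree_integral_transfer {V : Type*} [Fintype V] [DecidableEq V]
    (T : SimpleGraph V) (hT : T.IsTree) (L : V → ℕ)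
    (y : V → ℝ) (hy01 : ∀ v, 0 ≤ y v ∧ y v ≤ 1)
    (hnonleaf : ∀ v, 2 ≤ T.degree v → y v = 1)
    (hint : ∃ n : ℕ, ∑ v, y v = n) :
    ∃ F : Finset V, IsIntegralTransfer T Finset.univ L 2 y F := by
  have hconn := hT.connected
  obtain ⟨r⟩ := hconn.nonempty
  have hpar : ∀ x, ∃ w, x ≠ r → T.Adj x w ∧ T.dist w r + 1 = T.dist x r := fun x => by
    by_cases hx : x = r
    · exact ⟨x, fun h => absurd hx h⟩
    · obtain ⟨q, hq⟩ := hconn.exists_walk_length_eq_dist x r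
      cases q with
      | nil => exact absurd rfl hx
      | @cons _ w _ hw q =>
        refine ⟨w, fun _ => ⟨hw, ?_⟩⟩
        have h1 := SimpleGraph.dist_le q
        have h2 := hconn.dist_triangle (u := x) (v := w) (w := r)
        rw [SimpleGraph.dist_eq_one_iff_adj.2 hw] at h2
        rw [SimpleGraph.Walk.length_cons] at hq
        omega
  choose p hp using hpar
  have hwalk : ∀ {a b : V} (q : T.Walk a b), q.length ≤ 2 → T.edist a b ≤ ((2 : ℕ) : ℕ∞) :=
    fun q hq => (SimpleGraph.edist_le q).trans (by exact_mod_cast hq)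
  obtain ⟨n, hn⟩ := hint
  obtain ⟨F, -, hcard, hF⟩ := exists_isRelTransfer_of_parent
    (fun a b => T.edist a b ≤ ((2 : ℕ) : ℕ∞)) r p (fun x => T.dist x r)
    (fun x hx => (hp x hx).2) (fun x => hwalk .nil (by simp))
    (fun x hx => hwalk (hp x hx).1.toWalk (by simp))
    (fun x hx => hwalk (hp x hx).1.symm.toWalk (by simp))
    (fun x z hx hz h => hwalk
      (.cons (hp x hx).1 (.cons (h ▸ (hp z hz).1.symm) .nil)) (by simp))
    Finset.univ (fun v => (L v : ℝ)) y (fun v => Nat.cast_nonneg _) hy01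
    (fun x _ _ => Finset.mem_univ _)
    (fun x _ hx hpx => hnonleaf _ (by
      rw [← SimpleGraph.card_neighborFinset_eq_degree]
      refine Finset.one_lt_card.2 ⟨x, by simpa using (hp x hx).1.symm, p (p x),
        by simpa using (hp _ hpx).1, fun h => ?_⟩
      have h1 := (hp x hx).2
      have h2 := (hp _ hpx).2
      rw [← h] at h2
      omega))
    ⟨n, by rw [hn]; simp⟩
  refine ⟨F, Finset.subset_univ _, ?_, fun U hU => (hF U hU).trans_eq ?_⟩
  · rw [← hcard]; simp
  · simp only [mul_ite, mul_one, mul_zero, ← Finset.sum_filter, Finset.filter_filter]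
    refine Finset.sum_congr ?_ fun _ _ => rfl
    ext v
    simp [and_comm]
end

section
/- Let G be a finite connected bipartite graph with client vertex set 𝒞 and facility vertex set ℱ, and let S ⊆ ℱ be such that d(v, S) ≤ 5 for every vertex v ∈ 𝒞 ∪ ℱ, where d is the shortest-path distance in G. Then there exists a tree T with vertex set S such that d(u, u') ≤ 10 for every edge {u, u'} of T. -/
open Finset

open scoped Classical

/-- In a graphic instance, a walk between two facilities has even length. -/
theorem IsGraphicInstance.even_length {V : Type*} [Fintype V] {G : SimpleGraph V}
    {Cs Fs : Finset V} (hinst : IsGraphicInstance G Cs Fs) {s t : V}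
    (hs : s ∈ Fs) (ht : t ∈ Fs) (p : G.Walk s t) : Even p.length := by
  let c : G.Coloring Bool := SimpleGraph.Coloring.mk (fun v => decide (v ∈ Fs)) (by
    intro u v huv
    rcases hinst.2.2 u v huv with ⟨hu, hv⟩ | ⟨hu, hv⟩
    · simp [hv, Finset.disjoint_left.mp hinst.1 hu]
    · simp [hu, Finset.disjoint_left.mp hinst.1 hv])
  have hcs : c s = true := decide_eq_true hs
  have hct : c t = true := decide_eq_true ht
  rw [c.even_length_iff_congr p, hcs, hct]

/-- In a graphic instance, two facilities close to the two ends of an edge are at distance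
at most 10: the length 11 is excluded by parity. -/
theorem IsGraphicInstance.edist_le_ten {V : Type*} [Fintype V] {G : SimpleGraph V}
    {Cs Fs : Finset V} (hinst : IsGraphicInstance G Cs Fs) {a b s t : V}
    (hs : s ∈ Fs) (ht : t ∈ Fs) (hab : G.Adj a b)
    (has : G.edist a s ≤ 5) (hbt : G.edist b t ≤ 5) : G.edist s t ≤ 10 := by
  obtain ⟨p, hp⟩ := SimpleGraph.exists_walk_of_edist_ne_top
    (ne_top_of_le_ne_top (ENat.natCast_ne_top 5) has)
  obtain ⟨q, hq⟩ := SimpleGraph.exists_walk_of_edist_ne_top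
    (ne_top_of_le_ne_top (ENat.natCast_ne_top 5) hbt)
  have hp5 : p.length ≤ 5 := by exact_mod_cast hp ▸ has
  have hq5 : q.length ≤ 5 := by exact_mod_cast hq ▸ hbt
  let w := p.reverse.append (SimpleGraph.Walk.cons hab q)
  have hw : w.length = p.length + (q.length + 1) := by simp [w]
  have hw_even : Even w.length := hinst.even_length hs ht w
  have hw10 : w.length ≤ 10 := by grind
  exact w.edist_le.trans (by exact_mod_cast hw10)

/-- If `G` is a connected bipartite graph and every vertex is at distance
at most 5 from `S ⊆ ℱ`, then there is a tree on the vertex set `S` whose edges join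
vertices at distance at most 10 in `G`. -/
theorem auxiliary_tree {V : Type*} [Fintype V] [DecidableEq V]
    (G : SimpleGraph V) (Cs Fs : Finset V)
    (hinst : IsGraphicInstance G Cs Fs)
    (hconn : G.Connected)
    (S : Finset V) (hSF : S ⊆ Fs)
    (hcov : ∀ v : V, ∃ s ∈ S, G.edist v s ≤ 5) :
    ∃ T : SimpleGraph {v : V // v ∈ S}, T.IsTree ∧
      ∀ u v : {v : V // v ∈ S}, T.Adj u v → G.edist u.1 v.1 ≤ 10 := by
  let H : SimpleGraph {v : V // v ∈ S} :=
    { Adj := fun u v => u ≠ v ∧ G.edist u.1 v.1 ≤ 10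
      symm := ⟨fun u v h => ⟨h.1.symm, SimpleGraph.edist_comm (G := G) ▸ h.2⟩⟩
      loopless := ⟨fun u h => h.1 rfl⟩ }
  have reach (u v : {v : V // v ∈ S}) (h : G.edist u.1 v.1 ≤ 10) : H.Reachable u v := by
    by_cases huv : u = v
    · exact huv ▸ SimpleGraph.Reachable.refl u
    · exact SimpleGraph.Adj.reachable (G := H) ⟨huv, h⟩
  choose f hfS hf using hcov
  let g (v : V) : {v : V // v ∈ S} := ⟨f v, hfS v⟩
  have walk_reach {a b : V} (p : G.Walk a b) : H.Reachable (g a) (g b) := by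
    induction p with
    | nil => exact SimpleGraph.Reachable.refl _
    | cons hab _ ih =>
      exact (reach _ _ (hinst.edist_le_ten (hSF (hfS _)) (hSF (hfS _)) hab
        (hf _) (hf _))).trans ih
  have reach_g (s : {v : V // v ∈ S}) : H.Reachable s (g s.1) :=
    reach _ _ ((hf s.1).trans (by norm_num))
  have hH : H.Connected :=
    { preconnected := fun s t =>
        ((reach_g s).trans (walk_reach (hconn s.1 t.1).some)).trans (reach_g t).symm
      nonempty := ⟨g hconn.nonempty.some⟩ }
  obtain ⟨T, hTH, hT⟩ := hH.exists_isTree_le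
  exact ⟨T, hT, fun u v huv => (hTH huv).2⟩
end

section
/- Let (G, L, k, p) be a graphic instance of capacitated k-supplier with outliers, let S ⊆ ℱ, let (x, y) be a feasible solution of LP_{k,p}(G, L, S), and let F ⊆ ℱ be an integral distance-r transfer of (G, L, y) (taking W = ℱ). Then for every U ⊆ 𝒞 it holds that Σ_{u∈F : d(u,U) ≤ r+1} L(u) ≥ |U| − |𝒞| + p. -/
open Finset

open scoped Classical

/-- Given a feasible LP solution `(x, y)` and an integral distance-`r`
transfer `F` of `(G, L, y)`, the deficiency version of Hall's condition holds: for every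
set `U` of clients, the total capacity of facilities of `F` within distance `r + 1` of `U`
is at least `|U| - |𝒞| + p`. -/
theorem hall_condition {V : Type*} [Fintype V] [DecidableEq V]
    (G : SimpleGraph V) (Cs Fs : Finset V) (L : V → ℕ) (k p r : ℕ)
    (hinst : IsGraphicInstance G Cs Fs)
    (S : Finset V) (hSF : S ⊆ Fs)
    (x : V → V → ℝ) (y : V → ℝ) (hxy : LPSat G Cs Fs L k p S x y)
    (F : Finset V) (hF : IsIntegralTransfer G Fs L r y F) :
    ∀ U ⊆ Cs,
      (U.card : ℤ) - Cs.card + p ≤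
        ∑ u ∈ F.filter (fun u => ∃ v ∈ U, G.edist u v ≤ (r : ℕ∞) + 1), (L u : ℤ) := by
  intro U hU
  obtain ⟨-, hx, -, hp, -, hcap, hcl, -, hadj⟩ := hxy
  obtain ⟨hFs, -, htr⟩ := hF
  set N := Fs.filter (fun u => ∃ v ∈ U, G.Adj v u)
  have hN : N ⊆ Fs := Finset.filter_subset _ _
  have hserved : ∑ v ∈ U, ∑ u ∈ Fs, x u v ≤ ∑ u ∈ N, (L u : ℝ) * y u :=
    calc ∑ v ∈ U, ∑ u ∈ Fs, x u v = ∑ v ∈ U, ∑ u ∈ N, x u v := by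
          refine Finset.sum_congr rfl fun v hv => (Finset.sum_subset hN fun u hu hu' => ?_).symm
          exact hadj u hu v (hU hv) fun h => hu' (Finset.mem_filter.2 ⟨hu, v, hv, h⟩)
      _ = ∑ u ∈ N, ∑ v ∈ U, x u v := Finset.sum_comm
      _ ≤ ∑ u ∈ N, (L u : ℝ) * y u := Finset.sum_le_sum fun u hu =>
          (Finset.sum_le_sum_of_subset_of_nonneg hU fun v _ _ => (hx u v).1).trans
            (hcap u (hN hu))
  have hrest : ∑ v ∈ Cs \ U, ∑ u ∈ Fs, x u v ≤ (Cs.card : ℝ) - U.card := by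
    calc ∑ v ∈ Cs \ U, ∑ u ∈ Fs, x u v ≤ ∑ v ∈ Cs \ U, (1 : ℝ) :=
          Finset.sum_le_sum fun v hv => hcl v (Finset.mem_sdiff.1 hv).1
      _ = (Cs.card : ℝ) - U.card := by
          rw [Finset.sum_const, nsmul_eq_mul, mul_one, Finset.cast_card_sdiff hU]
  have hsplit : ∑ v ∈ Cs \ U, ∑ u ∈ Fs, x u v + ∑ v ∈ U, ∑ u ∈ Fs, x u v = p := by
    rw [Finset.sum_sdiff hU, Finset.sum_comm, hp]
  have hball : ∑ v ∈ Fs.filter (fun v => ∃ u ∈ N, G.edist v u ≤ (r : ℕ∞)),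
        (L v : ℝ) * (if v ∈ F then 1 else 0) ≤
      ∑ u ∈ F.filter (fun u => ∃ v ∈ U, G.edist u v ≤ (r : ℕ∞) + 1), (L u : ℝ) := by
    simp only [mul_ite, mul_one, mul_zero]
    rw [← Finset.sum_filter]
    refine Finset.sum_le_sum_of_subset_of_nonneg (fun w hw => ?_) fun _ _ _ => Nat.cast_nonneg _
    simp only [Finset.mem_filter] at hw ⊢
    obtain ⟨⟨-, u, hu, hwu⟩, hwF⟩ := hw
    obtain ⟨-, v, hv, hvu⟩ := Finset.mem_filter.1 hu
    exact ⟨hwF, v, hv, G.edist_triangle.trans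
      (add_le_add hwu (SimpleGraph.edist_eq_one_iff_adj.2 hvu.symm).le)⟩
  have hreal : (U.card : ℝ) - Cs.card + p ≤
      ∑ u ∈ F.filter (fun u => ∃ v ∈ U, G.edist u v ≤ (r : ℕ∞) + 1), (L u : ℝ) := by
    linarith [htr N hN]
  exact_mod_cast hreal
end

section
/- Let T = (V, E) be a finite tree, let c ∈ ℕ and let L : V → ℕ be the constant capacity function L(v) = c for all v ∈ V. Let y ∈ ℝ_{≥0}^V be a vector such that Σ_{v∈V} y_v is an integer and y_v ≥ 1 for every non-leaf vertex v of T. Then there exists a vector y'' ∈ ℤ_{≥0}^V that is a distance-1 transfer of (T, L, y). -/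
open Finset

open scoped Classical

/-- In a connected graph every vertex other than `r` has a neighbour strictly closer to `r`. -/
theorem SimpleGraph.Connected.exists_adj_dist_lt {V : Type*} {G : SimpleGraph V}
    (hG : G.Connected) {r v : V} (hv : v ≠ r) : ∃ u, G.Adj v u ∧ G.dist u r < G.dist v r := by
  obtain ⟨p, hp⟩ := hG.exists_walk_length_eq_dist v r
  cases p with
  | nil => exact absurd rfl hv
  | @cons _ u _ h q =>
    refine ⟨u, h, ?_⟩
    have := SimpleGraph.dist_le q
    rw [SimpleGraph.Walk.length_cons] at hp
    omega

/-- Subtree sums of `y` for the parent function `p` on a finite set rooted at `r`. -/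
theorem exists_subtree_sum {V : Type*} [Fintype V] (r : V) (p : V → V) (d : V → ℕ)
    (hd : ∀ v, v ≠ r → d (p v) < d v) (y : V → ℝ) :
    ∃ S : V → ℝ, ∀ v, S v = y v + ∑ w with w ≠ r ∧ p w = v, S w := by
  let R : V → V → Prop := fun w v => d v < d w
  have : IsTrans V R := ⟨fun _ _ _ h₁ h₂ => lt_trans h₂ h₁⟩
  have : Std.Irrefl R := ⟨fun _ => lt_irrefl _⟩
  have wf : WellFounded R := Finite.wellFounded_of_trans_of_irrefl R
  refine ⟨wf.fix fun v S => y v + ∑ w, if h : w ≠ r ∧ p w = v then S w (h.2 ▸ hd w h.1) else 0,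
    fun v => ?_⟩
  rw [wf.fix_eq, Finset.sum_filter]
  simp only [dite_eq_ite]

/-- In a connected graph with mass at least one on every vertex of degree at least two, nonnegative
mass of integral total can be made integral by moving, from each vertex `v` other than a root `r`,
an amount `f v ≤ y v` to a neighbour `p v`. -/
theorem SimpleGraph.Connected.exists_integral_flow {V : Type*} [Fintype V] {G : SimpleGraph V}
    (hG : G.Connected) (y : V → ℝ) (hy : ∀ v, 0 ≤ y v)
    (hnonleaf : ∀ v, 2 ≤ G.degree v → 1 ≤ y v) (hint : ∃ n : ℕ, ∑ v, y v = n) :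
    ∃ (r : V) (p : V → V) (f : V → ℝ) (z : V → ℕ), (∀ v, v ≠ r → G.Adj v (p v)) ∧
      (∀ v, 0 ≤ f v) ∧ (∀ v, f v ≤ y v) ∧ f r = 0 ∧
      ∀ v, (z v : ℝ) = y v - f v + ∑ w with w ≠ r ∧ p w = v, f w := by
  obtain ⟨r⟩ := hG.nonempty
  choose! p hadj hlt using fun v (hv : v ≠ r) => hG.exists_adj_dist_lt hv
  obtain ⟨S, hS⟩ := exists_subtree_sum r p (G.dist · r) hlt y
  have hroot : S r = ∑ v, y v := by
    have h₁ : ∑ v, S v = ∑ v, y v + ∑ v, ∑ w with w ≠ r ∧ p w = v, S w := by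
      rw [← Finset.sum_add_distrib]
      exact Finset.sum_congr rfl fun v _ => hS v
    have h₂ : ∑ v, ∑ w with w ≠ r ∧ p w = v, S w = ∑ w with w ≠ r, S w := by
      simp_rw [← Finset.filter_filter]
      exact Finset.sum_fiberwise _ p S
    have h₃ := Finset.sum_filter_add_sum_filter_not Finset.univ (· ≠ r) S
    rw [show ({v | ¬v ≠ r} : Finset V) = {r} by ext; simp, Finset.sum_singleton] at h₃
    linarith
  have hfr : Int.fract (S r) = 0 := by
    obtain ⟨n, hn⟩ := hint
    rw [hroot, hn, Int.fract_natCast]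
  have hz : ∀ v, 0 ≤ ⌊S v⌋ - ∑ w with w ≠ r ∧ p w = v, ⌊S w⌋ := fun v => by
    rw [sub_nonneg, Int.le_floor, Int.cast_sum, hS v]
    exact le_add_of_nonneg_of_le (hy v) (Finset.sum_le_sum fun w _ => Int.floor_le (S w))
  refine ⟨r, p, fun v => Int.fract (S v),
    fun v => (⌊S v⌋ - ∑ w with w ≠ r ∧ p w = v, ⌊S w⌋).toNat, hadj,
    fun v => Int.fract_nonneg _, fun v => ?_, hfr, fun v => ?_⟩ <;> beta_reduce
  · rcases eq_or_ne v r with rfl | hv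
    · rw [hfr]
      exact hy v
    by_cases hc : ∃ w, w ≠ r ∧ p w = v
    · obtain ⟨w, hw, rfl⟩ := hc
      refine (Int.fract_lt_one _).le.trans (hnonleaf _ ?_)
      have hne : p (p w) ≠ w := fun h => by
        have h₁ := hlt _ hv
        have h₂ := hlt _ hw
        rw [h] at h₁
        omega
      rw [← G.card_neighborFinset_eq_degree, ← Finset.card_pair hne]
      refine Finset.card_le_card fun x hx => ?_
      rw [SimpleGraph.mem_neighborFinset]
      rcases Finset.mem_insert.1 hx with rfl | hx
      · exact hadj _ hv
      · rw [Finset.mem_singleton.1 hx]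
        exact (hadj _ hw).symm
    · have hSv : S v = y v := by
        rw [hS v, Finset.filter_false_of_mem fun w _ h => hc ⟨w, h⟩, Finset.sum_empty, add_zero]
      have := Int.cast_nonneg (R := ℝ) (Int.floor_nonneg.2 (hy v))
      rw [hSv, Int.fract]
      linarith
  · rw [← Int.cast_natCast, Int.toNat_of_nonneg (hz v)]
    simp only [Int.fract, Int.cast_sub, Int.cast_sum, Finset.sum_sub_distrib]
    linarith [hS v]

/-- For a finite tree `T` with constant capacities and a nonnegative
vector `y` of integral total mass with `y_v ≥ 1` on every non-leaf (degree at least 2)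
vertex, there is a nonnegative integer vector that is a distance-1 transfer of `(T, L, y)`. -/
theorem tree_uniform_transfer {V : Type*} [Fintype V] [DecidableEq V]
    (T : SimpleGraph V) (hT : T.IsTree) (c : ℕ) (L : V → ℕ) (hL : ∀ v, L v = c)
    (y : V → ℝ) (hy : ∀ v, 0 ≤ y v)
    (hnonleaf : ∀ v, 2 ≤ T.degree v → 1 ≤ y v)
    (hint : ∃ n : ℕ, ∑ v, y v = n) :
    ∃ y'' : V → ℝ, (∀ v, ∃ n : ℕ, y'' v = n) ∧ IsTransfer T Finset.univ L 1 y y'' := by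
  obtain ⟨r, p, f, z, hadj, hf, hfy, hfr, hz⟩ :=
    hT.connected.exists_integral_flow y hy (fun v hv => hnonleaf v (by convert hv)) hint
  have hsum (A : Finset V) :
      ∑ v ∈ A, (z v : ℝ) = ∑ v ∈ A, (y v - f v) + ∑ w with w ≠ r ∧ p w ∈ A, f w := by
    rw [Finset.sum_congr rfl fun v _ => hz v, Finset.sum_add_distrib]
    congr 1
    rw [← Finset.sum_fiberwise_of_maps_to (s := {w | w ≠ r ∧ p w ∈ A}) (t := A) (g := p)
      fun w hw => (Finset.mem_filter.1 hw).2.2]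
    refine Finset.sum_congr rfl fun v hv => Finset.sum_congr ?_ fun _ _ => rfl
    ext w
    simp only [Finset.mem_filter, Finset.mem_univ, true_and]
    constructor
    · rintro ⟨hw, rfl⟩
      exact ⟨⟨hw, hv⟩, rfl⟩
    · rintro ⟨⟨hw, -⟩, rfl⟩
      exact ⟨hw, rfl⟩
  have hroot (A : Finset V) : ∑ v ∈ A with v ≠ r, f v = ∑ v ∈ A, f v := by
    refine Finset.sum_filter_of_ne fun v _ hv h => hv ?_
    rw [h, hfr]
  refine ⟨fun v => z v, fun v => ⟨z v, rfl⟩, ?_, fun U _ => ?_⟩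
  · rw [hsum, Finset.sum_sub_distrib]
    simp only [Finset.mem_univ, and_true]
    rw [hroot, sub_add_cancel]
  · simp only [hL, ← Finset.mul_sum]
    refine mul_le_mul_of_nonneg_left ?_ c.cast_nonneg
    rw [hsum]
    have h₁ : ∑ u ∈ U, y u = ∑ u ∈ U, (y u - f u) + ∑ u ∈ U with u ≠ r, f u := by
      rw [hroot, Finset.sum_sub_distrib, sub_add_cancel]
    rw [h₁]
    refine add_le_add
      (Finset.sum_le_sum_of_subset_of_nonneg (fun u hu => ?_) fun v _ _ => sub_nonneg.2 (hfy v))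
      (Finset.sum_le_sum_of_subset_of_nonneg (fun u hu => ?_) fun v _ _ => hf v)
    · exact Finset.mem_filter.2 ⟨Finset.mem_univ _, u, hu, by simp⟩
    · obtain ⟨hu, hur⟩ := Finset.mem_filter.1 hu
      refine Finset.mem_filter.2 ⟨Finset.mem_univ _, hur,
        Finset.mem_filter.2 ⟨Finset.mem_univ _, u, hu, ?_⟩⟩
      rw [SimpleGraph.edist_eq_one_iff_adj.2 (hadj u hur).symm, Nat.cast_one]
end
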